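/- arXiv:2601.20249 — 2 statements merged into one kernel-verified Lean document; each statement's English description precedes it below -/
import Mathlib

section
/- Let H be a Hopf algebra over a field k. If the Gorenstein projective dimension Gpd_H(εk) of the trivial left H-module εk is finite, then there exists a monomorphism of left H-modules ι : εk → Λ such that pd_H(Λ) = Gpd_H(εk). -/
open TensorProduct

universe u

noncomputable section GorensteinCore

/-- `ProjDimLE R n M` : the left `R`-module `M` has a projective resolution of length `≤ n`. -/
def ProjDimLE (R : Type u) [Ring R] : ℕ → (M : Type u) → [AddCommGroup M] → [Module R M] → Prop
  | 0, M, _, _ => Module.Projective R M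
  | (n+1), M, _, _ => Module.Projective R M ∨
      ∃ (P : ModuleCat.{u} R) (f : P →ₗ[R] M), Module.Projective R P ∧
      Function.Surjective f ∧ ProjDimLE R n (LinearMap.ker f)

/-- The projective dimension of a module, as an element of `ℕ∞` (`⊤` = infinite). -/
def projDim (R : Type u) [Ring R] (M : Type u) [AddCommGroup M] [Module R M] : ℕ∞ :=
  sInf {n : ℕ∞ | ∃ m : ℕ, n = (m : ℕ∞) ∧ ProjDimLE R m M}

/-- A module is Gorenstein projective if it is a syzygy of a totally acyclic complex of
projective modules. -/
def IsGorensteinProjective (R : Type u) [Ring R] (M : Type u) [AddCommGroup M] [Module R M] :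
    Prop :=
  ∃ (P : ℤ → ModuleCat.{u} R) (d : ∀ i : ℤ, P (i+1) →ₗ[R] P i),
    (∀ i, Module.Projective R (P i)) ∧
    (∀ i, LinearMap.range (d (i+1)) = LinearMap.ker (d i)) ∧
    (∀ (Q : ModuleCat.{u} R), Module.Projective R Q →
      ∀ (i : ℤ) (f : P (i+1) →ₗ[R] Q), f.comp (d (i+1)) = 0 →
        ∃ g : P i →ₗ[R] Q, g.comp (d i) = f) ∧
    Nonempty (M ≃ₗ[R] LinearMap.ker (d 0))

/-- `GProjDimLE R n M` : `M` has a Gorenstein projective resolution of length `≤ n`. -/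
def GProjDimLE (R : Type u) [Ring R] : ℕ → (M : Type u) → [AddCommGroup M] → [Module R M] → Prop
  | 0, M, _, _ => IsGorensteinProjective R M
  | (n+1), M, _, _ => IsGorensteinProjective R M ∨
      ∃ (G : ModuleCat.{u} R) (f : G →ₗ[R] M), IsGorensteinProjective R G ∧
      Function.Surjective f ∧ GProjDimLE R n (LinearMap.ker f)

/-- The Gorenstein projective dimension of a module, as an element of `ℕ∞`. -/
def gProjDim (R : Type u) [Ring R] (M : Type u) [AddCommGroup M] [Module R M] : ℕ∞ :=
  sInf {n : ℕ∞ | ∃ m : ℕ, n = (m : ℕ∞) ∧ GProjDimLE R m M}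

/-- The (left) Gorenstein global dimension of a ring `R`. -/
def lGgldim (R : Type u) [Ring R] : ℕ∞ :=
  ⨆ M : ModuleCat.{u} R, gProjDim R M

/-- The (left) global dimension of a ring `R`. -/
def lgldim (R : Type u) [Ring R] : ℕ∞ :=
  ⨆ M : ModuleCat.{u} R, projDim R M

/-- `InjDimLE R n M` : the left `R`-module `M` has an injective resolution of length `≤ n`. -/
def InjDimLE (R : Type u) [Ring R] : ℕ → (M : Type u) → [AddCommGroup M] → [Module R M] → Prop
  | 0, M, _, _ => Module.Injective R M
  | (n+1), M, _, _ => Module.Injective R M ∨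
      ∃ (I : ModuleCat.{u} R) (f : M →ₗ[R] I), Module.Injective R I ∧
      Function.Injective f ∧ InjDimLE R n (I ⧸ LinearMap.range f)

/-- The injective dimension of a module, as an element of `ℕ∞`. -/
def injDim (R : Type u) [Ring R] (M : Type u) [AddCommGroup M] [Module R M] : ℕ∞ :=
  sInf {n : ℕ∞ | ∃ m : ℕ, n = (m : ℕ∞) ∧ InjDimLE R m M}

/-- `silp R` : the supremum of the injective dimensions of projective left `R`-modules. -/
def silp (R : Type u) [Ring R] : ℕ∞ :=
  ⨆ (M : ModuleCat.{u} R) (_ : Module.Projective R M), injDim R M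

/-- `spli R` : the supremum of the projective dimensions of injective left `R`-modules. -/
def spli (R : Type u) [Ring R] : ℕ∞ :=
  ⨆ (M : ModuleCat.{u} R) (_ : Module.Injective R M), projDim R M

end GorensteinCore
noncomputable section HopfCore

variable (k : Type u) [CommRing k] (H : Type u) [Ring H] [HopfAlgebra k H]

/-- The trivial left `H`-module structure on `k`, given by the counit. -/
def trivModule : Module H k :=
  Module.compHom k ((Bialgebra.counitAlgHom k H : H →ₐ[k] k) : H →+* k)

/-- The trivial left `H`-module `εk`, as an object of `ModuleCat H`. -/
def trivMod : ModuleCat.{u} H :=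
  @ModuleCat.of H _ k _ (trivModule k H)

/-- The counit of `H`, as a ring homomorphism out of `Hᵐᵒᵖ`. -/
def counitOp : Hᵐᵒᵖ →+* k :=
  RingHom.fromOpposite ((Bialgebra.counitAlgHom k H : H →ₐ[k] k) : H →+* k)
    (fun _ _ => mul_comm _ _)

/-- The trivial right `H`-module structure on `k` (as a left `Hᵐᵒᵖ`-module). -/
def trivModuleOp : Module Hᵐᵒᵖ k :=
  Module.compHom k (counitOp k H)

/-- The trivial right `H`-module `k_ε`, as an object of `ModuleCat Hᵐᵒᵖ`. -/
def trivModOp : ModuleCat.{u} Hᵐᵒᵖ :=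
  @ModuleCat.of Hᵐᵒᵖ _ k _ (trivModuleOp k H)

section TensorAction

variable (M N : Type u) [AddCommGroup M] [Module k M] [Module H M]
  [IsScalarTower k H M] [SMulCommClass k H M]
  [AddCommGroup N] [Module k N] [Module H N] [IsScalarTower k H N] [SMulCommClass k H N]

/-- The representation of `H` on a left `H`-module `M`, as an algebra morphism to
`End_k(M)`. -/
def hRep : H →ₐ[k] Module.End k M :=
  (Algebra.lsmul k k M : H →ₐ[k] Module.End k M)

/-- The representation of `H` on `M ⊗[k] N` given by the comultiplication of `H`:
`h • (m ⊗ n) = ∑ h₁ • m ⊗ h₂ • n`. -/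
def tensorRep : H →ₐ[k] Module.End k (M ⊗[k] N) :=
  ((Module.endTensorEndAlgHom (R := k) (S := k) (A := k) (M := M) (N := N)).comp
    (Algebra.TensorProduct.map (hRep k H M) (hRep k H N))).comp
    (Bialgebra.comulAlgHom k H)

/-- The diagonal left `H`-module structure on `M ⊗[k] N`:
`h • (m ⊗ n) = ∑ h₁ • m ⊗ h₂ • n`. -/
def tensorModule : Module H (M ⊗[k] N) :=
  Module.compHom (M ⊗[k] N)
    ((tensorRep k H M N).toRingHom : H →+* Module.End k (M ⊗[k] N))

/-- The tensor product `M ⊗[k] N` with its diagonal left `H`-module structure, as an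
object of `ModuleCat H`. -/
def tensorMod : ModuleCat.{u} H :=
  @ModuleCat.of H _ (M ⊗[k] N) _ (tensorModule k H M N)

end TensorAction

end HopfCore


section ShortExact

variable {R : Type u} [Ring R]

/-- `0 → A → B → C → 0` is a short exact sequence of modules. -/
def IsShortExact {A B C : Type u} [AddCommGroup A] [Module R A] [AddCommGroup B] [Module R B]
    [AddCommGroup C] [Module R C] (i : A →ₗ[R] B) (p : B →ₗ[R] C) : Prop :=
  Function.Injective i ∧ Function.Surjective p ∧ ∀ b, p b = 0 ↔ ∃ a, i a = b

variable {A B C X Y : Type u} [AddCommGroup A] [Module R A] [AddCommGroup B] [Module R B]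
  [AddCommGroup C] [Module R C] [AddCommGroup X] [Module R X] [AddCommGroup Y] [Module R Y]

lemma IsShortExact.comp_apply {i : A →ₗ[R] B} {p : B →ₗ[R] C} (h : IsShortExact i p) (a : A) :
    p (i a) = 0 :=
  (h.2.2 _).2 ⟨a, rfl⟩

lemma isShortExact_subtype_ker {p : B →ₗ[R] C} (hp : Function.Surjective p) :
    IsShortExact (LinearMap.ker p).subtype p :=
  ⟨Subtype.val_injective, hp, fun b => ⟨fun h => ⟨⟨b, h⟩, rfl⟩, by rintro ⟨a, rfl⟩; exact a.2⟩⟩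

lemma isShortExact_mkQ_range {i : A →ₗ[R] B} (hi : Function.Injective i) :
    IsShortExact i (LinearMap.range i).mkQ :=
  ⟨hi, Submodule.mkQ_surjective _, fun b => by simp⟩

/-- A map vanishing on the kernel of a surjection factors through it. -/
lemma exists_comp_eq_of_ker_le {p : B →ₗ[R] C} (hp : Function.Surjective p) (f : B →ₗ[R] X)
    (h : ∀ b, p b = 0 → f b = 0) : ∃ g : C →ₗ[R] X, ∀ b, g (p b) = f b := by
  refine ⟨((LinearMap.ker p).liftQ f (fun b hb => h b hb)).comp
    (p.quotKerEquivOfSurjective hp).symm.toLinearMap, fun b => ?_⟩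
  have : (p.quotKerEquivOfSurjective hp).symm (p b) = (LinearMap.ker p).mkQ b := by
    rw [LinearEquiv.symm_apply_eq]
    rfl
  rw [LinearMap.comp_apply, LinearEquiv.coe_coe, this]
  exact Submodule.liftQ_apply _ _ _

/-- A map with values in the range of an injection factors through it. -/
lemma exists_comp_eq_of_le_range {i : A →ₗ[R] B} (hi : Function.Injective i) (f : X →ₗ[R] B)
    (h : ∀ x, ∃ a, i a = f x) : ∃ g : X →ₗ[R] A, ∀ x, i (g x) = f x := by
  refine ⟨(LinearEquiv.ofInjective i hi).symm.toLinearMap.comp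
    (f.codRestrict (LinearMap.range i) h), fun x => ?_⟩
  have := (LinearEquiv.ofInjective i hi).apply_symm_apply (f.codRestrict (LinearMap.range i) h x)
  exact congrArg Subtype.val this

/-- The pushout of two short exact sequences with the same left end. -/
lemma exists_pushout {i : A →ₗ[R] B} {p : B →ₗ[R] X} {j : A →ₗ[R] C} {q : C →ₗ[R] Y}
    (hip : IsShortExact i p) (hjq : IsShortExact j q) :
    ∃ (D : ModuleCat.{u} R) (b : B →ₗ[R] D) (b' : D →ₗ[R] Y) (c : C →ₗ[R] D) (c' : D →ₗ[R] X),
      IsShortExact b b' ∧ IsShortExact c c' := by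
  let S : Submodule R (B × C) := LinearMap.range (i.prod (-j))
  have hS : ∀ x y, (x, y) ∈ S ↔ ∃ a, i a = x ∧ -j a = y := by
    intro x y
    simp [S, LinearMap.mem_range]
  let b' : (B × C) ⧸ S →ₗ[R] Y := S.liftQ (q.comp (LinearMap.snd R B C)) (by
    rintro _ ⟨a, rfl⟩
    simp [hjq.comp_apply])
  let c' : (B × C) ⧸ S →ₗ[R] X := S.liftQ (p.comp (LinearMap.fst R B C)) (by
    rintro _ ⟨a, rfl⟩
    simp [hip.comp_apply])
  have hb' : ∀ x y, b' (S.mkQ (x, y)) = q y := fun x y => rfl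
  have hc' : ∀ x y, c' (S.mkQ (x, y)) = p x := fun x y => rfl
  have h0 : ∀ x y, S.mkQ (x, y) = 0 ↔ ∃ a, i a = x ∧ -j a = y := by
    intro x y
    rw [← hS]
    exact Submodule.Quotient.mk_eq_zero S
  refine ⟨ModuleCat.of R ((B × C) ⧸ S), S.mkQ.comp (LinearMap.inl R B C), b',
    S.mkQ.comp (LinearMap.inr R B C), c', ⟨?_, ?_, ?_⟩, ⟨?_, ?_, ?_⟩⟩
  · refine (injective_iff_map_eq_zero _).2 fun x hx => ?_
    obtain ⟨a, rfl, ha⟩ := (h0 x 0).1 hx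
    have : a = 0 := (injective_iff_map_eq_zero _).1 hjq.1 a (by simpa using ha)
    simp [this]
  · intro y
    obtain ⟨z, rfl⟩ := hjq.2.1 y
    exact ⟨S.mkQ (0, z), rfl⟩
  · intro d
    obtain ⟨⟨x, y⟩, rfl⟩ := S.mkQ_surjective d
    constructor
    · intro h
      obtain ⟨a, rfl⟩ := (hjq.2.2 y).1 h
      refine ⟨x + i a, ?_⟩
      change S.mkQ (x + i a, 0) = S.mkQ (x, j a)
      rw [← sub_eq_zero, ← map_sub]
      exact (h0 _ _).2 ⟨a, by simp, by simp⟩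
    · rintro ⟨z, hz⟩
      rw [← hz]
      exact (hb' z 0).trans (map_zero q)
  · refine (injective_iff_map_eq_zero _).2 fun y hy => ?_
    obtain ⟨a, ha, rfl⟩ := (h0 0 y).1 hy
    have : a = 0 := (injective_iff_map_eq_zero _).1 hip.1 a ha
    simp [this]
  · intro x
    obtain ⟨z, rfl⟩ := hip.2.1 x
    exact ⟨S.mkQ (z, 0), rfl⟩
  · intro d
    obtain ⟨⟨x, y⟩, rfl⟩ := S.mkQ_surjective d
    constructor
    · intro h
      obtain ⟨a, rfl⟩ := (hip.2.2 x).1 h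
      refine ⟨y + j a, ?_⟩
      change S.mkQ (0, y + j a) = S.mkQ (i a, y)
      rw [← sub_eq_zero, ← map_sub]
      exact (h0 _ _).2 ⟨-a, by simp, by simp⟩
    · rintro ⟨z, hz⟩
      rw [← hz]
      exact (hc' 0 z).trans (map_zero p)

end ShortExact

section ExtensionProperty

variable {R : Type u} [Ring R]

/-- `Ext¹_R(X, Q) = 0` for every projective module `Q`: whenever `X` is a quotient of `B`, maps from
the kernel to a projective module extend to `B`. -/
def ExtProjVanishes (R : Type u) [Ring R] (X : Type u) [AddCommGroup X] [Module R X] : Prop :=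
  ∀ (A B Q : ModuleCat.{u} R) (i : A →ₗ[R] B) (p : B →ₗ[R] X), IsShortExact i p →
    Module.Projective R Q → ∀ f : A →ₗ[R] Q, ∃ g : B →ₗ[R] Q, ∀ a, g (i a) = f a

variable {A B C X : Type u} [AddCommGroup A] [Module R A] [AddCommGroup B] [Module R B]
  [AddCommGroup C] [Module R C] [AddCommGroup X] [Module R X]

/-- The vanishing of `Ext¹` can be tested on one projective presentation. -/
lemma ExtProjVanishes.of_presentation [Module.Projective R B] {i : A →ₗ[R] B} {p : B →ₗ[R] X}
    (hip : IsShortExact i p)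
    (h : ∀ Q : ModuleCat.{u} R, Module.Projective R Q → ∀ f : A →ₗ[R] Q,
      ∃ g : B →ₗ[R] Q, ∀ a, g (i a) = f a) :
    ExtProjVanishes R X := by
  intro A' B' Q j q hjq hQ f
  obtain ⟨φ, hφ⟩ := Module.projective_lifting_property q p hjq.2.1
  have hφ' : ∀ x, q (φ x) = p x := fun x => LinearMap.congr_fun hφ x
  obtain ⟨ψ, hψ⟩ := exists_comp_eq_of_le_range hjq.1 (φ.comp i) (fun a => (hjq.2.2 _).1 (by
    simp [hφ', hip.comp_apply]))
  obtain ⟨g, hg⟩ := h Q hQ (f.comp ψ)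
  have hsurj : Function.Surjective (j.coprod φ) := by
    intro b
    obtain ⟨x, hx⟩ := hip.2.1 (q b)
    obtain ⟨a, ha⟩ := (hjq.2.2 (b - φ x)).1 (by simp [hφ', hx])
    exact ⟨(a, x), by simp [ha]⟩
  obtain ⟨e, he⟩ := exists_comp_eq_of_ker_le hsurj (f.coprod g) (by
    rintro ⟨a, x⟩ hax
    simp only [LinearMap.coprod_apply] at hax ⊢
    have hx : p x = 0 := by
      have := congrArg q hax
      simpa [hφ', hjq.comp_apply] using this
    obtain ⟨c, rfl⟩ := (hip.2.2 x).1 hx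
    have hac : a = -ψ c := hjq.1 (by
      rw [map_neg, hψ]
      exact eq_neg_of_add_eq_zero_left hax)
    rw [hg, hac]
    simp)
  exact ⟨e, fun a => by simpa using he (a, 0)⟩

lemma ExtProjVanishes.of_projective [Module.Projective R X] : ExtProjVanishes R X := by
  refine .of_presentation (A := PUnit.{u+1}) (i := 0) (p := LinearMap.id)
    ⟨fun _ _ _ => rfl, Function.surjective_id, fun b => ?_⟩ fun Q _ f => ⟨0, fun a => ?_⟩
  · simp [eq_comm]
  · rw [Subsingleton.elim a 0, map_zero, map_zero, map_zero]

lemma ExtProjVanishes.of_isShortExact {i : A →ₗ[R] X} {p : X →ₗ[R] C} (hip : IsShortExact i p)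
    (hA : ExtProjVanishes R A) (hC : ExtProjVanishes R C) : ExtProjVanishes R X := by
  intro A' B' Q j q hjq hQ f
  let S : Submodule R B' := LinearMap.ker (p.comp q)
  have hS : IsShortExact S.subtype (p.comp q) :=
    isShortExact_subtype_ker (hip.2.1.comp hjq.2.1)
  obtain ⟨r, hr⟩ := exists_comp_eq_of_le_range hip.1 (q.comp S.subtype)
    (fun s => (hip.2.2 _).1 s.2)
  have hr' : ∀ s : S, i (r s) = q s := hr
  have hj : ∀ a, j a ∈ S := fun a => by simp [S, hjq.comp_apply]
  have h1 : IsShortExact (j.codRestrict S hj) r := by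
    refine ⟨fun a b hab => hjq.1 (congrArg Subtype.val hab), fun a => ?_, fun s => ?_⟩
    · obtain ⟨b, hb⟩ := hjq.2.1 (i a)
      refine ⟨⟨b, by simp [S, hb, hip.comp_apply]⟩, hip.1 ?_⟩
      rw [hr', hb]
    · rw [← map_eq_zero_iff i hip.1, hr', hjq.2.2]
      exact exists_congr fun a => (Subtype.ext_iff (a1 := j.codRestrict S hj a) (a2 := s)).symm
  obtain ⟨g, hg⟩ := hA A' (ModuleCat.of R S) Q _ r h1 hQ f
  obtain ⟨e, he⟩ := hC (ModuleCat.of R S) B' Q _ _ hS hQ g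
  exact ⟨e, fun a => (he ⟨j a, hj a⟩).trans (hg a)⟩

end ExtensionProperty

section GorensteinProjective

variable {R : Type u} [Ring R]

lemma exists_int_sequence {T : Type*} (r : T → T → Prop) (hr : ∀ x, ∃ y, r x y)
    (hl : ∀ y, ∃ x, r x y) (n : ℤ) (x : T) :
    ∃ s : ℤ → T, s n = x ∧ ∀ i, r (s i) (s (i + 1)) := by
  choose a ha using hr
  choose b hb using hl
  let t : ℤ → T := fun i => match i with
    | Int.ofNat m => a^[m] x
    | Int.negSucc m => b^[m + 1] x
  have ht : ∀ i, r (t i) (t (i + 1)) := by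
    rintro (m | m)
    · change r (a^[m] x) (a^[m + 1] x)
      rw [Function.iterate_succ_apply']
      exact ha _
    · have : t (Int.negSucc m + 1) = b^[m] x := by
        cases m <;> rfl
      rw [this]
      change r (b^[m + 1] x) _
      rw [Function.iterate_succ_apply']
      exact hb _
  refine ⟨fun i => t (i - n), by simp [t], fun i => ?_⟩
  have := ht (i - n)
  rwa [sub_add_eq_add_sub] at this

/-- A class of modules with vanishing `Ext¹` into projectives, closed under taking suitable
syzygies and cosyzygies, consists of Gorenstein projective modules. -/
lemma isGorensteinProjective_of_class (𝒞 : ModuleCat.{u} R → Prop)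
    (hext : ∀ X, 𝒞 X → ExtProjVanishes R X)
    (hright : ∀ X, 𝒞 X → ∃ (P Y : ModuleCat.{u} R) (i : X →ₗ[R] P) (p : P →ₗ[R] Y),
      Module.Projective R P ∧ IsShortExact i p ∧ 𝒞 Y)
    (hleft : ∀ X, 𝒞 X → ∃ (P Y : ModuleCat.{u} R) (i : Y →ₗ[R] P) (p : P →ₗ[R] X),
      Module.Projective R P ∧ IsShortExact i p ∧ 𝒞 Y)
    (X : ModuleCat.{u} R) (hX : 𝒞 X) : IsGorensteinProjective R X := by
  obtain ⟨s, hs, hr⟩ := exists_int_sequence (T := {X : ModuleCat.{u} R // 𝒞 X})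
    (fun X Y => ∃ (P : ModuleCat.{u} R) (i : Y.1 →ₗ[R] P) (p : P →ₗ[R] X.1),
      Module.Projective R P ∧ IsShortExact i p)
    (fun X => by
      obtain ⟨P, Y, i, p, hP, hip, hY⟩ := hleft X.1 X.2
      exact ⟨⟨Y, hY⟩, P, i, p, hP, hip⟩)
    (fun X => by
      obtain ⟨P, Y, i, p, hP, hip, hY⟩ := hright X.1 X.2
      exact ⟨⟨Y, hY⟩, P, i, p, hP, hip⟩) (0 + 1 + 1) ⟨X, hX⟩
  choose P i p hP hip using hr
  have hker : ∀ n x, (i n) (p (n + 1) x) = 0 ↔ ∃ a, i (n + 1) a = x := fun n x => by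
    rw [map_eq_zero_iff _ (hip n).1, (hip (n + 1)).2.2]
  refine ⟨P, fun n => (i n).comp (p (n + 1)), hP, fun n => ?_, fun Q hQ n f hf => ?_, ?_⟩
  · ext x
    rw [LinearMap.mem_ker, LinearMap.comp_apply, hker, LinearMap.mem_range]
    constructor
    · rintro ⟨y, rfl⟩
      exact ⟨_, rfl⟩
    · rintro ⟨a, rfl⟩
      obtain ⟨y, rfl⟩ := (hip (n + 1 + 1)).2.1 a
      exact ⟨y, rfl⟩
  · obtain ⟨g, hg⟩ := exists_comp_eq_of_ker_le (hip (n + 1)).2.1 f (fun x hx => by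
      obtain ⟨a, rfl⟩ := ((hip (n + 1)).2.2 x).1 hx
      obtain ⟨y, rfl⟩ := (hip (n + 1 + 1)).2.1 a
      exact LinearMap.congr_fun hf y)
    obtain ⟨e, he⟩ := hext _ (s n).2 _ _ Q _ _ (hip n) hQ g
    refine ⟨e, LinearMap.ext fun x => ?_⟩
    rw [LinearMap.comp_apply, LinearMap.comp_apply, he, hg]
  · have hX' : X = (s (0 + 1 + 1)).1 := by rw [hs]
    rw [hX']
    have hrange : LinearMap.range (i (0 + 1)) = LinearMap.ker ((i 0).comp (p (0 + 1))) := by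
      ext x
      rw [LinearMap.mem_ker, LinearMap.comp_apply, hker, LinearMap.mem_range]
    exact ⟨(LinearEquiv.ofInjective _ (hip (0 + 1)).1).trans (LinearEquiv.ofEq _ _ hrange)⟩

/-- Totally acyclic complexes of projective modules. -/
def IsTotallyAcyclic (P : ℤ → ModuleCat.{u} R) (d : ∀ i : ℤ, P (i + 1) →ₗ[R] P i) : Prop :=
  (∀ i, Module.Projective R (P i)) ∧
  (∀ i, LinearMap.range (d (i + 1)) = LinearMap.ker (d i)) ∧
  (∀ (Q : ModuleCat.{u} R), Module.Projective R Q →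
    ∀ (i : ℤ) (f : P (i + 1) →ₗ[R] Q), f.comp (d (i + 1)) = 0 →
      ∃ g : P i →ₗ[R] Q, g.comp (d i) = f)

/-- `X` is a syzygy, in some degree, of a totally acyclic complex. -/
def IsTotallyAcyclicSyzygy (X : ModuleCat.{u} R) : Prop :=
  ∃ (P : ℤ → ModuleCat.{u} R) (d : ∀ i : ℤ, P (i + 1) →ₗ[R] P i) (n : ℤ),
    IsTotallyAcyclic P d ∧ Nonempty (X ≃ₗ[R] LinearMap.ker (d n))

lemma IsTotallyAcyclic.exists_isShortExact {P : ℤ → ModuleCat.{u} R}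
    {d : ∀ i : ℤ, P (i + 1) →ₗ[R] P i} (h : IsTotallyAcyclic P d) (n : ℤ)
    {X : ModuleCat.{u} R} (e : X ≃ₗ[R] LinearMap.ker (d n)) :
    ∃ p : P (n + 1 + 1) →ₗ[R] X, (∀ x, (e (p x) : P (n + 1)) = d (n + 1) x) ∧
      IsShortExact (LinearMap.ker (d (n + 1))).subtype p := by
  have hd : ∀ x, d (n + 1) x ∈ LinearMap.ker (d n) := fun x => by
    rw [← h.2.1 n]
    exact ⟨x, rfl⟩
  have hval : ∀ x, (e (e.symm ((d (n + 1)).codRestrict _ hd x)) : P (n + 1)) = d (n + 1) x := by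
    intro x
    rw [LinearEquiv.apply_symm_apply]
    rfl
  refine ⟨e.symm.toLinearMap.comp ((d (n + 1)).codRestrict _ hd), hval,
    Subtype.val_injective, fun y => ?_, fun x => ?_⟩
  · obtain ⟨x, hx⟩ := (h.2.1 n).ge (e y).2
    refine ⟨x, e.injective (Subtype.ext ?_)⟩
    exact (hval x).trans hx
  · rw [← map_eq_zero_iff e e.injective, ← Subtype.coe_inj]
    refine (Eq.congr_left (hval x)).trans ⟨fun hx => ⟨⟨x, hx⟩, rfl⟩, ?_⟩
    rintro ⟨y, rfl⟩
    exact y.2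

lemma IsTotallyAcyclicSyzygy.exists_left {X : ModuleCat.{u} R} (hX : IsTotallyAcyclicSyzygy X) :
    ∃ (P Y : ModuleCat.{u} R) (i : Y →ₗ[R] P) (p : P →ₗ[R] X),
      Module.Projective R P ∧ IsShortExact i p ∧ IsTotallyAcyclicSyzygy Y := by
  obtain ⟨P, d, n, h, ⟨e⟩⟩ := hX
  obtain ⟨p, -, hp⟩ := h.exists_isShortExact n e
  exact ⟨P (n + 1 + 1), ModuleCat.of R (LinearMap.ker (d (n + 1))), _, p, h.1 _, hp, P, d, n + 1, h,
    ⟨LinearEquiv.refl _ _⟩⟩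

lemma IsTotallyAcyclicSyzygy.exists_right {X : ModuleCat.{u} R} (hX : IsTotallyAcyclicSyzygy X) :
    ∃ (P Y : ModuleCat.{u} R) (i : X →ₗ[R] P) (p : P →ₗ[R] Y),
      Module.Projective R P ∧ IsShortExact i p ∧ IsTotallyAcyclicSyzygy Y := by
  obtain ⟨P, d, n, h, ⟨e⟩⟩ := hX
  obtain ⟨m, rfl⟩ : ∃ m, n = m + 1 := ⟨n - 1, by simp⟩
  let Y := ModuleCat.of R (LinearMap.ker (d m))
  obtain ⟨p, -, hp⟩ := h.exists_isShortExact (X := Y) m (LinearEquiv.refl _ _)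
  refine ⟨P (m + 1 + 1), Y, (LinearMap.ker (d (m + 1))).subtype.comp e.toLinearMap, p, h.1 _,
    ⟨hp.1.comp e.injective, hp.2.1, fun b => ?_⟩, P, d, m, h, ⟨LinearEquiv.refl _ _⟩⟩
  rw [hp.2.2]
  exact (e.surjective.exists (p := fun a => (LinearMap.ker (d (m + 1))).subtype a = b))

lemma IsTotallyAcyclicSyzygy.extProjVanishes {X : ModuleCat.{u} R}
    (hX : IsTotallyAcyclicSyzygy X) : ExtProjVanishes R X := by
  obtain ⟨P, d, n, h, ⟨e⟩⟩ := hX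
  obtain ⟨p, -, hp⟩ := h.exists_isShortExact n e
  have := h.1 (n + 1 + 1)
  refine .of_presentation hp fun Q hQ f => ?_
  obtain ⟨q, hq, hq'⟩ := h.exists_isShortExact
    (X := ModuleCat.of R (LinearMap.ker (d (n + 1)))) (n + 1) (LinearEquiv.refl _ _)
  obtain ⟨g, hg⟩ := h.2.2 Q hQ (n + 1 + 1) (f.comp q) (LinearMap.ext fun x => by
    have : q (d (n + 1 + 1 + 1) x) = 0 := (hq'.2.2 _).2
      ⟨⟨_, (h.2.1 (n + 1 + 1)).le ⟨x, rfl⟩⟩, rfl⟩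
    simp [this])
  refine ⟨g, fun a => ?_⟩
  obtain ⟨x, rfl⟩ := hq'.2.1 a
  exact (congrArg g (hq x)).trans (LinearMap.congr_fun hg x)

lemma IsTotallyAcyclicSyzygy.isGorensteinProjective {X : ModuleCat.{u} R}
    (hX : IsTotallyAcyclicSyzygy X) : IsGorensteinProjective R X :=
  isGorensteinProjective_of_class IsTotallyAcyclicSyzygy (fun _ h => h.extProjVanishes)
    (fun _ h => h.exists_right) (fun _ h => h.exists_left) X hX

variable {M : Type u} [AddCommGroup M] [Module R M]

lemma IsGorensteinProjective.isTotallyAcyclicSyzygy (hM : IsGorensteinProjective R M) :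
    IsTotallyAcyclicSyzygy (ModuleCat.of R M) := by
  obtain ⟨P, d, h1, h2, h3, e⟩ := hM
  exact ⟨P, d, 0, ⟨h1, h2, h3⟩, e⟩

lemma IsGorensteinProjective.extProjVanishes (hM : IsGorensteinProjective R M) :
    ExtProjVanishes R M :=
  hM.isTotallyAcyclicSyzygy.extProjVanishes

lemma IsGorensteinProjective.exists_left (hM : IsGorensteinProjective R M) :
    ∃ (P Y : ModuleCat.{u} R) (i : Y →ₗ[R] P) (p : P →ₗ[R] M),
      Module.Projective R P ∧ IsShortExact i p ∧ IsGorensteinProjective R Y := by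
  obtain ⟨P, Y, i, p, hP, hip, hY⟩ := hM.isTotallyAcyclicSyzygy.exists_left
  exact ⟨P, Y, i, p, hP, hip, hY.isGorensteinProjective⟩

lemma IsGorensteinProjective.exists_right (hM : IsGorensteinProjective R M) :
    ∃ (P Y : ModuleCat.{u} R) (i : M →ₗ[R] P) (p : P →ₗ[R] Y),
      Module.Projective R P ∧ IsShortExact i p ∧ IsGorensteinProjective R Y := by
  obtain ⟨P, Y, i, p, hP, hip, hY⟩ := hM.isTotallyAcyclicSyzygy.exists_right
  exact ⟨P, Y, i, p, hP, hip, hY.isGorensteinProjective⟩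

variable {A B C : Type u} [AddCommGroup A] [Module R A] [AddCommGroup B] [Module R B]
  [AddCommGroup C] [Module R C]

lemma IsGorensteinProjective.of_projective [Module.Projective R M] :
    IsGorensteinProjective R M := by
  refine isGorensteinProjective_of_class (fun X => Module.Projective R X)
    (fun X hX => .of_projective) (fun X hX => ?_) (fun X hX => ?_) (ModuleCat.of R M) ‹_›
  · refine ⟨X, ModuleCat.of R PUnit.{u + 1}, LinearMap.id, 0, hX,
      ⟨Function.injective_id, fun y => ⟨0, rfl⟩, fun b => by simp⟩, ?_⟩
    change Module.Projective R PUnit.{u + 1}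
    infer_instance
  · refine ⟨X, ModuleCat.of R PUnit.{u + 1}, 0, LinearMap.id, hX,
      ⟨fun _ _ _ => rfl, Function.surjective_id, fun b => by simp [eq_comm]⟩, ?_⟩
    change Module.Projective R PUnit.{u + 1}
    infer_instance

/-- Horseshoe lemma for cosyzygies. -/
lemma exists_isShortExact_cosyzygy {i : A →ₗ[R] B} {p : B →ₗ[R] C} (hip : IsShortExact i p)
    {PA A' PC C' : ModuleCat.{u} R} {jA : A →ₗ[R] PA} {qA : PA →ₗ[R] A'} {jC : C →ₗ[R] PC}
    {qC : PC →ₗ[R] C'} (hA : IsShortExact jA qA) (hC : IsShortExact jC qC)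
    (v : B →ₗ[R] PA) (hv : ∀ a, v (i a) = jA a) :
    ∃ (B' : ModuleCat.{u} R) (j : B →ₗ[R] PA × PC) (q : PA × PC →ₗ[R] B') (i' : A' →ₗ[R] B')
      (p' : B' →ₗ[R] C'), IsShortExact j q ∧ IsShortExact i' p' := by
  let j : B →ₗ[R] PA × PC := v.prod (jC.comp p)
  have hj : Function.Injective j := by
    refine (injective_iff_map_eq_zero _).2 fun b hb => ?_
    have h1 : v b = 0 := congrArg Prod.fst hb
    have h2 : jC (p b) = 0 := congrArg Prod.snd hb
    obtain ⟨a, rfl⟩ := (hip.2.2 b).1 ((map_eq_zero_iff jC hC.1).1 h2)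
    rw [hv, map_eq_zero_iff _ hA.1] at h1
    simp [h1]
  let q : PA × PC →ₗ[R] (PA × PC) ⧸ LinearMap.range j := (LinearMap.range j).mkQ
  have hq : IsShortExact j q := isShortExact_mkQ_range hj
  obtain ⟨i', hi'⟩ := exists_comp_eq_of_ker_le hA.2.1 (q.comp (LinearMap.inl R PA PC)) (by
    intro x hx
    obtain ⟨a, rfl⟩ := (hA.2.2 x).1 hx
    refine (hq.2.2 _).2 ⟨i a, Prod.ext (hv a) ?_⟩
    simp [j, hip.comp_apply])
  obtain ⟨p', hp'⟩ := exists_comp_eq_of_ker_le hq.2.1 (qC.comp (LinearMap.snd R PA PC)) (by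
    intro x hx
    obtain ⟨b, rfl⟩ := (hq.2.2 x).1 hx
    exact hC.comp_apply _)
  refine ⟨ModuleCat.of R _, j, q, i', p', hq, ?_, ?_, fun b => ?_⟩
  · refine (injective_iff_map_eq_zero _).2 fun a ha => ?_
    obtain ⟨x, rfl⟩ := hA.2.1 a
    rw [hi'] at ha
    obtain ⟨b, hb⟩ := (hq.2.2 _).1 ha
    have h1 : v b = x := congrArg Prod.fst hb
    have h2 : jC (p b) = 0 := congrArg Prod.snd hb
    obtain ⟨a, rfl⟩ := (hip.2.2 b).1 ((map_eq_zero_iff jC hC.1).1 h2)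
    rw [← h1, hv, hA.comp_apply]
  · intro c
    obtain ⟨y, rfl⟩ := hC.2.1 c
    exact ⟨q (0, y), hp' _⟩
  · obtain ⟨⟨x, y⟩, rfl⟩ := hq.2.1 b
    rw [hp']
    constructor
    · intro h
      obtain ⟨c, rfl⟩ := (hC.2.2 y).1 h
      obtain ⟨b, rfl⟩ := hip.2.1 c
      refine ⟨qA (x - v b), ?_⟩
      rw [hi', ← sub_eq_zero, LinearMap.comp_apply, ← map_sub]
      refine (hq.2.2 _).2 ⟨-b, ?_⟩
      simp [j]
    · rintro ⟨a, ha⟩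
      obtain ⟨z, rfl⟩ := hA.2.1 a
      rw [← hp', ← ha, hi', LinearMap.comp_apply, hp']
      simp

/-- Horseshoe lemma for syzygies. -/
lemma exists_isShortExact_syzygy {i : A →ₗ[R] B} {p : B →ₗ[R] C} (hip : IsShortExact i p)
    {PA A' PC C' : ModuleCat.{u} R} {jA : A' →ₗ[R] PA} {qA : PA →ₗ[R] A} {jC : C' →ₗ[R] PC}
    {qC : PC →ₗ[R] C} (hA : IsShortExact jA qA) (hC : IsShortExact jC qC)
    (v : PC →ₗ[R] B) (hv : ∀ y, p (v y) = qC y) :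
    ∃ (B' : ModuleCat.{u} R) (j : B' →ₗ[R] PA × PC) (q : PA × PC →ₗ[R] B) (i' : A' →ₗ[R] B')
      (p' : B' →ₗ[R] C'), IsShortExact j q ∧ IsShortExact i' p' := by
  let q : PA × PC →ₗ[R] B := (i.comp qA).coprod v
  have hqapp : ∀ x y, q (x, y) = i (qA x) + v y := fun x y => rfl
  have hq : Function.Surjective q := by
    intro b
    obtain ⟨y, hy⟩ := hC.2.1 (p b)
    obtain ⟨a, ha⟩ := (hip.2.2 (b - v y)).1 (by simp [hv, hy])
    obtain ⟨x, rfl⟩ := hA.2.1 a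
    exact ⟨(x, y), by simp [hqapp, ha]⟩
  let j := (LinearMap.ker q).subtype
  have hj : IsShortExact j q := isShortExact_subtype_ker hq
  obtain ⟨i', hi'⟩ := exists_comp_eq_of_le_range hj.1 ((LinearMap.inl R PA PC).comp jA) (by
    intro a
    exact (hj.2.2 _).1 (by simp [hqapp, hA.comp_apply]))
  obtain ⟨p', hp'⟩ := exists_comp_eq_of_le_range hC.1 ((LinearMap.snd R PA PC).comp j) (by
    intro b
    refine (hC.2.2 _).1 ?_
    have := congrArg p (hj.comp_apply b)
    rw [show j b = ((j b).1, (j b).2) from rfl, hqapp, map_add, hip.comp_apply, hv] at this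
    simpa using this)
  refine ⟨ModuleCat.of R (LinearMap.ker q), j, q, i', p', hj, ?_, ?_, fun b => ?_⟩
  · refine (injective_iff_map_eq_zero _).2 fun a ha => ?_
    have := hi' a
    rw [ha, map_zero] at this
    exact (map_eq_zero_iff jA hA.1).1 (congrArg Prod.fst this).symm
  · intro c
    obtain ⟨a, ha⟩ := (hip.2.2 (v (jC c))).1 (by rw [hv, hC.comp_apply])
    obtain ⟨x, rfl⟩ := hA.2.1 a
    obtain ⟨b, hb⟩ := (hj.2.2 (-x, jC c)).1 (by simp [hqapp, ha])
    refine ⟨b, hC.1 ?_⟩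
    rw [hp', LinearMap.comp_apply, hb]
    rfl
  · rw [← map_eq_zero_iff jC hC.1, hp']
    constructor
    · intro h
      have h2 : (j b).2 = 0 := h
      have := hj.comp_apply b
      rw [show j b = ((j b).1, (j b).2) from rfl, hqapp, h2, map_zero, add_zero,
        map_eq_zero_iff i hip.1] at this
      obtain ⟨a, ha⟩ := (hA.2.2 _).1 this
      refine ⟨a, hj.1 ?_⟩
      rw [hi']
      exact Prod.ext ha h2.symm
    · rintro ⟨a, rfl⟩
      rw [LinearMap.comp_apply, hi']
      rfl

/-- Gorenstein projective modules are closed under extensions. -/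
lemma IsGorensteinProjective.of_isShortExact {i : A →ₗ[R] M} {p : M →ₗ[R] C}
    (hip : IsShortExact i p) (hA : IsGorensteinProjective R A) (hC : IsGorensteinProjective R C) :
    IsGorensteinProjective R M := by
  refine isGorensteinProjective_of_class (fun X => ∃ (A C : ModuleCat.{u} R) (i : A →ₗ[R] X)
    (p : X →ₗ[R] C), IsShortExact i p ∧ IsGorensteinProjective R A ∧ IsGorensteinProjective R C)
    ?_ ?_ ?_ (ModuleCat.of R M) ⟨ModuleCat.of R A, ModuleCat.of R C, i, p, hip, hA, hC⟩
  · rintro X ⟨A, C, i, p, hip, hA, hC⟩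
    exact .of_isShortExact hip hA.extProjVanishes hC.extProjVanishes
  · rintro X ⟨A, C, i, p, hip, hA, hC⟩
    obtain ⟨PA, A', jA, qA, hPA, hA', hGA⟩ := hA.exists_right
    obtain ⟨PC, C', jC, qC, hPC, hC', hGC⟩ := hC.exists_right
    obtain ⟨v, hv⟩ := hC.extProjVanishes A X PA i p hip hPA jA
    obtain ⟨B', j, q, i', p', hj, hi'⟩ := exists_isShortExact_cosyzygy hip hA' hC' v hv
    exact ⟨ModuleCat.of R (PA × PC), B', j, q,
      inferInstanceAs (Module.Projective R (PA × PC)), hj, A', C', i', p', hi', hGA, hGC⟩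
  · rintro X ⟨A, C, i, p, hip, hA, hC⟩
    obtain ⟨PA, A', jA, qA, hPA, hA', hGA⟩ := hA.exists_left
    obtain ⟨PC, C', jC, qC, hPC, hC', hGC⟩ := hC.exists_left
    obtain ⟨v, hv⟩ := Module.projective_lifting_property p qC hip.2.1
    obtain ⟨B', j, q, i', p', hj, hi'⟩ := exists_isShortExact_syzygy hip hA' hC' v
      (fun y => LinearMap.congr_fun hv y)
    exact ⟨ModuleCat.of R (PA × PC), B', j, q,
      inferInstanceAs (Module.Projective R (PA × PC)), hj, A', C', i', p', hi', hGA, hGC⟩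

/-- The kernel `K` of a surjection from a projective to a Gorenstein projective module is itself the
quotient of a projective module by a Gorenstein projective one, with the expected extension
property. -/
lemma exists_presentation_of_cosyzygy [Module.Projective R B] {i : A →ₗ[R] B} {p : B →ₗ[R] C}
    (hip : IsShortExact i p) (hC : IsGorensteinProjective R C) :
    ∃ (E Y : ModuleCat.{u} R) (j : Y →ₗ[R] E) (q : E →ₗ[R] A),
      Module.Projective R E ∧ IsShortExact j q ∧ IsGorensteinProjective R Y ∧
      ∀ Q : ModuleCat.{u} R, Module.Projective R Q → ∀ f : Y →ₗ[R] Q,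
        ∃ g : E →ₗ[R] Q, ∀ y, g (j y) = f y := by
  obtain ⟨P₁, G₁, i₁, p₁, hP₁, h₁, hG₁⟩ := hC.exists_left
  obtain ⟨P₂, G₂, i₂, p₂, hP₂, h₂, hG₂⟩ := hG₁.exists_left
  obtain ⟨ψ, hψ⟩ := Module.projective_lifting_property p₁ p h₁.2.1
  have hψ' : ∀ x, p₁ (ψ x) = p x := fun x => LinearMap.congr_fun hψ x
  let t : P₂ × B →ₗ[R] P₁ := (i₁.comp p₂).coprod ψ
  have htapp : ∀ x y, t (x, y) = i₁ (p₂ x) + ψ y := fun x y => rfl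
  have ht : Function.Surjective t := by
    intro z
    obtain ⟨y, hy⟩ := hip.2.1 (p₁ z)
    obtain ⟨g, hg⟩ := (h₁.2.2 (z - ψ y)).1 (by simp [hψ', hy])
    obtain ⟨x, rfl⟩ := h₂.2.1 g
    exact ⟨(x, y), by simp [htapp, hg]⟩
  let E := LinearMap.ker t
  have hE : Module.Projective R E := by
    obtain ⟨σ, hσ⟩ := Module.projective_lifting_property t LinearMap.id ht
    have hσ' : ∀ z, t (σ z) = z := fun z => LinearMap.congr_fun hσ z
    refine Module.Projective.of_split E.subtype
      ((LinearMap.id - σ.comp t).codRestrict E fun x => by simp [E, hσ'])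
      (LinearMap.ext fun x => ?_)
    · refine Subtype.ext ?_
      have : t x = 0 := x.2
      simp [this]
  obtain ⟨q, hq⟩ := exists_comp_eq_of_le_range hip.1 ((LinearMap.snd R P₂ B).comp E.subtype) (by
    intro e
    refine (hip.2.2 _).1 ?_
    have he : t (e.1.1, e.1.2) = 0 := e.2
    have := congrArg p₁ he
    rw [htapp, map_add, h₁.comp_apply, hψ'] at this
    simpa using this)
  let j : G₂ →ₗ[R] E := ((LinearMap.inl R P₂ B).comp i₂).codRestrict E fun y => by
    simp [E, htapp, h₂.comp_apply]
  refine ⟨ModuleCat.of R E, G₂, j, q, hE, ⟨?_, ?_, fun e => ?_⟩, hG₂, fun Q hQ f => ?_⟩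
  · intro a b hab
    exact h₂.1 (congrArg (fun e : E => e.1.1) hab)
  · intro a
    obtain ⟨g, hg⟩ := (h₁.2.2 (ψ (i a))).1 (by rw [hψ', hip.comp_apply])
    obtain ⟨x, rfl⟩ := h₂.2.1 g
    refine ⟨⟨(-x, i a), by simp [E, htapp, hg]⟩, hip.1 ?_⟩
    rw [hq]
    rfl
  · rw [← map_eq_zero_iff i hip.1, hq]
    constructor
    · intro h
      have h2 : e.1.2 = 0 := h
      have he : t (e.1.1, e.1.2) = 0 := e.2
      rw [htapp, h2, map_zero, add_zero, map_eq_zero_iff i₁ h₁.1] at he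
      obtain ⟨y, hy⟩ := (h₂.2.2 _).1 he
      exact ⟨y, Subtype.ext (Prod.ext hy h2.symm)⟩
    · rintro ⟨y, rfl⟩
      rfl
  · obtain ⟨g, hg⟩ := hG₁.extProjVanishes G₂ P₂ Q i₂ p₂ h₂ hQ f
    exact ⟨(g.comp (LinearMap.fst R P₂ B)).comp E.subtype, hg⟩

/-- The kernel of a surjection from a projective module to a Gorenstein projective module is
Gorenstein projective. -/
lemma IsGorensteinProjective.of_isShortExact_projective [Module.Projective R B] {i : M →ₗ[R] B}
    {p : B →ₗ[R] C} (hip : IsShortExact i p) (hC : IsGorensteinProjective R C) :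
    IsGorensteinProjective R M := by
  refine isGorensteinProjective_of_class (fun X => ∃ (B C : ModuleCat.{u} R) (i : X →ₗ[R] B)
    (p : B →ₗ[R] C), Module.Projective R B ∧ IsShortExact i p ∧ IsGorensteinProjective R C)
    ?_ ?_ ?_ (ModuleCat.of R M) ⟨ModuleCat.of R B, ModuleCat.of R C, i, p, ‹_›, hip, hC⟩
  · rintro X ⟨B, C, i, p, hB, hip, hC⟩
    obtain ⟨E, Y, j, q, hE, hjq, -, h⟩ := exists_presentation_of_cosyzygy hip hC
    exact .of_presentation hjq h
  · rintro X ⟨B, C, i, p, hB, hip, hC⟩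
    exact ⟨B, C, i, p, hB, hip, hC.exists_right⟩
  · rintro X ⟨B, C, i, p, hB, hip, hC⟩
    obtain ⟨E, Y, j, q, hE, hjq, hY, -⟩ := exists_presentation_of_cosyzygy hip hC
    exact ⟨E, Y, j, q, hE, hjq, hY.exists_right⟩

end GorensteinProjective

section Dimension

variable {R : Type u} [Ring R]

lemma ProjDimLE.of_linearEquiv {n : ℕ} {M N : Type u} [AddCommGroup M] [Module R M]
    [AddCommGroup N] [Module R N] (e : M ≃ₗ[R] N) (h : ProjDimLE R n M) : ProjDimLE R n N := by
  cases n with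
  | zero =>
    have : Module.Projective R M := h
    exact Module.Projective.of_equiv e
  | succ n =>
    rcases h with h | ⟨P, f, hP, hf, hker⟩
    · exact Or.inl (Module.Projective.of_equiv e)
    · refine Or.inr ⟨P, e.toLinearMap.comp f, hP, e.surjective.comp hf, ?_⟩
      rwa [LinearEquiv.ker_comp]

lemma ProjDimLE.succ_of_isShortExact {n : ℕ} {A P M : Type u} [AddCommGroup A] [Module R A]
    [AddCommGroup P] [Module R P] [AddCommGroup M] [Module R M] [Module.Projective R P]
    {i : A →ₗ[R] P} {p : P →ₗ[R] M} (hip : IsShortExact i p) (h : ProjDimLE R n A) :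
    ProjDimLE R (n + 1) M := by
  refine Or.inr ⟨ModuleCat.of R P, p, ‹_›, hip.2.1, h.of_linearEquiv ?_⟩
  have : LinearMap.range i = LinearMap.ker p := by
    ext x
    rw [LinearMap.mem_ker, hip.2.2, LinearMap.mem_range]
  exact (LinearEquiv.ofInjective i hip.1).trans (LinearEquiv.ofEq _ _ this)

lemma ProjDimLE.gProjDimLE {n : ℕ} {M : Type u} [AddCommGroup M] [Module R M]
    (h : ProjDimLE R n M) : GProjDimLE R n M := by
  induction n generalizing M with
  | zero =>
    have : Module.Projective R M := h
    exact IsGorensteinProjective.of_projective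
  | succ n ih =>
    rcases h with h | ⟨P, f, hP, hf, hker⟩
    · exact Or.inl IsGorensteinProjective.of_projective
    · exact Or.inr ⟨P, f, IsGorensteinProjective.of_projective, hf, ih hker⟩

/-- A module of Gorenstein projective dimension at most `n` embeds in a module of projective
dimension at most `n`, with Gorenstein projective cokernel. -/
lemma GProjDimLE.exists_isShortExact {n : ℕ} {M : Type u} [AddCommGroup M] [Module R M]
    (h : GProjDimLE R n M) :
    ∃ (L G : ModuleCat.{u} R) (i : M →ₗ[R] L) (p : L →ₗ[R] G),
      IsShortExact i p ∧ ProjDimLE R n L ∧ IsGorensteinProjective R G := by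
  induction n generalizing M with
  | zero =>
    obtain ⟨P, G, i, p, hP, hip, hG⟩ := IsGorensteinProjective.exists_right h
    exact ⟨P, G, i, p, hip, hP, hG⟩
  | succ n ih =>
    rcases h with h | ⟨G, f, hG, hf, hker⟩
    · obtain ⟨P, G, i, p, hP, hip, hG⟩ := IsGorensteinProjective.exists_right h
      exact ⟨P, G, i, p, hip, Or.inl hP, hG⟩
    · obtain ⟨L, G', j, q, hjq, hL, hG'⟩ := ih hker
      obtain ⟨D, b, b', c, c', hb, hc⟩ := exists_pushout (isShortExact_subtype_ker hf) hjq
      have hD : IsGorensteinProjective R D := .of_isShortExact hb hG hG'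
      obtain ⟨P, G'', s, t, hP, hst, hG''⟩ := hD.exists_right
      have hπ := isShortExact_mkQ_range (i := s.comp c) (hst.1.comp hc.1)
      set π := (LinearMap.range (s.comp c)).mkQ
      obtain ⟨ι, hι⟩ := exists_comp_eq_of_ker_le hc.2.1 (π.comp s) (by
        intro d hd
        obtain ⟨l, rfl⟩ := (hc.2.2 d).1 hd
        exact hπ.comp_apply l)
      obtain ⟨r, hr⟩ := exists_comp_eq_of_ker_le hπ.2.1 t (by
        intro x hx
        obtain ⟨l, rfl⟩ := (hπ.2.2 x).1 hx
        exact hst.comp_apply _)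
      refine ⟨ModuleCat.of R (P ⧸ LinearMap.range (s.comp c)), G'', ι, r, ⟨?_, ?_, fun x => ?_⟩,
        ProjDimLE.succ_of_isShortExact hπ hL, hG''⟩
      · refine (injective_iff_map_eq_zero _).2 fun m hm => ?_
        obtain ⟨d, rfl⟩ := hc.2.1 m
        rw [hι] at hm
        obtain ⟨l, hl⟩ := (hπ.2.2 _).1 hm
        rw [← hst.1 hl, hc.comp_apply]
      · intro g
        obtain ⟨x, rfl⟩ := hst.2.1 g
        exact ⟨π x, hr x⟩
      · obtain ⟨x, rfl⟩ := hπ.2.1 x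
        rw [hr]
        constructor
        · intro hx
          obtain ⟨d, rfl⟩ := (hst.2.2 x).1 hx
          exact ⟨c' d, hι d⟩
        · rintro ⟨m, hm⟩
          obtain ⟨d, rfl⟩ := hc.2.1 m
          rw [← hr, ← hm, hι, LinearMap.comp_apply, hr, hst.comp_apply]

lemma GProjDimLE.of_isShortExact {n : ℕ} {M L G : Type u} [AddCommGroup M] [Module R M]
    [AddCommGroup L] [Module R L] [AddCommGroup G] [Module R G] {i : M →ₗ[R] L} {p : L →ₗ[R] G}
    (hip : IsShortExact i p) (hL : ProjDimLE R n L) (hG : IsGorensteinProjective R G) :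
    GProjDimLE R n M := by
  cases n with
  | zero =>
    have : Module.Projective R L := hL
    exact .of_isShortExact_projective hip hG
  | succ n =>
    rcases hL with hL | ⟨P, f, hP, hf, hker⟩
    · exact Or.inl (.of_isShortExact_projective hip hG)
    · have hN := isShortExact_subtype_ker (p := p.comp f) (hip.2.1.comp hf)
      set N := LinearMap.ker (p.comp f)
      have hNG : IsGorensteinProjective R N := .of_isShortExact_projective hN hG
      obtain ⟨g, hg⟩ := exists_comp_eq_of_le_range hip.1 (f.comp N.subtype)
        (fun x => (hip.2.2 _).1 x.2)
      have hg' : ∀ x : N, i (g x) = f x := hg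
      refine Or.inr ⟨ModuleCat.of R N, g, hNG, fun m => ?_,
        (ProjDimLE.of_linearEquiv ?_ hker).gProjDimLE⟩
      · obtain ⟨x, hx⟩ := hf (i m)
        refine ⟨⟨x, by simp [N, hx, hip.comp_apply]⟩, hip.1 ?_⟩
        rw [hg', hx]
      · have hle : LinearMap.ker f ≤ N := LinearMap.ker_le_ker_comp f p
        have hcomap : (LinearMap.ker f).comap N.subtype = LinearMap.ker g := by
          ext x
          rw [LinearMap.mem_ker, ← map_eq_zero_iff i hip.1, hg']
          rfl
        exact (Submodule.comapSubtypeEquivOfLe hle).symm.trans (LinearEquiv.ofEq _ _ hcomap)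

/-- A module of finite Gorenstein projective dimension embeds in a module whose projective dimension
is that number. -/
lemma exists_injective_projDim_eq_gProjDim {M : Type u} [AddCommGroup M] [Module R M]
    (hfin : gProjDim R M < ⊤) :
    ∃ (L : ModuleCat.{u} R) (i : M →ₗ[R] L),
      Function.Injective i ∧ projDim R L = gProjDim R M := by
  have hne : {n : ℕ∞ | ∃ m : ℕ, n = (m : ℕ∞) ∧ GProjDimLE R m M}.Nonempty := by
    by_contra h
    rw [Set.not_nonempty_iff_eq_empty] at h
    rw [gProjDim, h, sInf_empty] at hfin
    exact lt_irrefl _ hfin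
  obtain ⟨n, hn, hM⟩ := csInf_mem hne
  obtain ⟨L, G, i, p, hip, hL, hG⟩ := hM.exists_isShortExact
  refine ⟨L, i, hip.1, le_antisymm ?_ (le_sInf ?_)⟩
  · have : projDim R L ≤ n := sInf_le ⟨n, rfl, hL⟩
    exact this.trans hn.ge
  · rintro _ ⟨m, rfl, hm⟩
    exact sInf_le ⟨m, rfl, .of_isShortExact hip hm hG⟩

end Dimension

/-- Let `H` be a Hopf algebra over a field `k`. If the Gorenstein projective
dimension of the trivial left `H`-module `εk` is finite, then there exists a monomorphism of
left `H`-modules `ι : εk → Λ` with `pd_H(Λ) = Gpd_H(εk)`. -/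
theorem exists_mono_of_gProjDim_trivial_lt_top (k : Type u) [Field k]
    (H : Type u) [Ring H] [HopfAlgebra k H]
    (hfin : gProjDim H (trivMod k H) < ⊤) :
    ∃ (Λ : ModuleCat.{u} H) (ι : trivMod k H →ₗ[H] Λ),
      Function.Injective ι ∧ projDim H Λ = gProjDim H (trivMod k H) := by
  exact exists_injective_projDim_eq_gProjDim hfin
end

section
/- Let H be a Hopf algebra over a field k with bijective antipode, and assume there is a monomorphism of left H-modules ι : εk → Λ with pd_H(Λ) < ∞. Then for every left H-module M, the Gorenstein projective dimension satisfies Gpd_H(M) ≤ pd_H(Λ). -/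
open TensorProduct

universe u

open Coalgebra

section Twist

variable {k : Type*} [CommRing k] {C W : Type*} [AddCommGroup C] [Module k C]
  [AddCommGroup W] [Module k W]

/-- The map `h ⊗ w ↦ ∑ h₁ ⊗ φ(h₂) w`, where `δ h = ∑ h₁ ⊗ h₂`. -/
noncomputable def twist (δ : C →ₗ[k] C ⊗[k] C) (φ : C →ₗ[k] Module.End k W) :
    C ⊗[k] W →ₗ[k] C ⊗[k] W :=
  (TensorProduct.lift φ).lTensor C ∘ₗ (TensorProduct.assoc k C C W).toLinearMap ∘ₗ δ.rTensor W

lemma twist_tmul (δ : C →ₗ[k] C ⊗[k] C) (φ : C →ₗ[k] Module.End k W) (h : C) (w : W) :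
    twist δ φ (h ⊗ₜ w) = (φ.flip w).lTensor C (δ h) := by
  simp only [twist, LinearMap.comp_apply, LinearMap.rTensor_tmul, LinearEquiv.coe_coe]
  induction δ h with
  | zero => simp
  | add x y hx hy => simp only [TensorProduct.add_tmul, map_add, hx, hy]
  | tmul a b => simp

variable [Coalgebra k C]

/-- Coassociativity and the counit law `∑ h₁ ε(h₂) = h` for a map `δ : C → C ⊗ C`. -/
structure IsComul (δ : C →ₗ[k] C ⊗[k] C) : Prop where
  coassoc : ∀ h, TensorProduct.assoc k C C C (δ.rTensor C (δ h)) = δ.lTensor C (δ h)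
  counit : ∀ h, (counit (R := k) (A := C)).lTensor C (δ h) = h ⊗ₜ 1

lemma isComul_comul : IsComul (comul (R := k) (A := C)) :=
  ⟨coassoc_apply, lTensor_counit_comul⟩

lemma isComul_comm_comul :
    IsComul ((TensorProduct.comm k C C).toLinearMap ∘ₗ comul (R := k) (A := C)) := by
  constructor
  · intro h
    let rev : C ⊗[k] (C ⊗[k] C) →ₗ[k] C ⊗[k] (C ⊗[k] C) :=
      (TensorProduct.assoc k C C C).toLinearMap ∘ₗ
        (TensorProduct.comm k C C).toLinearMap.rTensor C ∘ₗ
        (TensorProduct.comm k C (C ⊗[k] C)).toLinearMap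
    have h₁ : ∀ t : C ⊗[k] C, TensorProduct.assoc k C C C
        (((TensorProduct.comm k C C).toLinearMap ∘ₗ comul).rTensor C (TensorProduct.comm k C C t)) =
        rev ((comul (R := k) (A := C)).lTensor C t) := by
      intro t
      induction t with
      | zero => simp
      | add x y hx hy => simp only [map_add, hx, hy]
      | tmul a b => simp [rev]
    have h₂ : ∀ t : C ⊗[k] C,
        ((TensorProduct.comm k C C).toLinearMap ∘ₗ comul).lTensor C (TensorProduct.comm k C C t) =
        rev (TensorProduct.assoc k C C C ((comul (R := k) (A := C)).rTensor C t)) := by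
      intro t
      induction t with
      | zero => simp
      | add x y hx hy => simp only [map_add, hx, hy]
      | tmul a b =>
        simp only [TensorProduct.comm_tmul, LinearMap.lTensor_tmul, LinearMap.rTensor_tmul,
          LinearMap.comp_apply]
        induction comul (R := k) a with
        | zero => simp
        | add x y hx hy => simp only [map_add, TensorProduct.add_tmul, TensorProduct.tmul_add, hx, hy]
        | tmul c d => simp [rev]
    simp only [LinearMap.comp_apply, LinearEquiv.coe_coe]
    rw [h₁, h₂, coassoc_apply]
  · intro h
    have h₁ : ∀ t : C ⊗[k] C, (counit (R := k) (A := C)).lTensor C (TensorProduct.comm k C C t) =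
        TensorProduct.comm k k C ((counit (R := k) (A := C)).rTensor C t) := by
      intro t
      induction t with
      | zero => simp
      | add x y hx hy => simp only [map_add, hx, hy]
      | tmul a b => simp
    simp [h₁]

lemma twist_twist {δ : C →ₗ[k] C ⊗[k] C} (hδ : IsComul δ) {φ ψ : C →ₗ[k] Module.End k W}
    (h : ∀ c w, TensorProduct.lift (φ.compl₂ (ψ.flip w)) (δ c) = counit (R := k) c • w)
    (z : C ⊗[k] W) : twist δ φ (twist δ ψ z) = z := by
  induction z with
  | zero => simp
  | add x y hx hy => simp only [map_add, hx, hy]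
  | tmul c w =>
    have h₁ : ∀ t : C ⊗[k] C, twist δ φ ((ψ.flip w).lTensor C t) =
        (TensorProduct.lift (φ.compl₂ (ψ.flip w))).lTensor C
          (TensorProduct.assoc k C C C (δ.rTensor C t)) := by
      intro t
      induction t with
      | zero => simp
      | add x y hx hy => simp only [map_add, hx, hy]
      | tmul a b =>
        simp only [LinearMap.lTensor_tmul, twist_tmul, LinearMap.rTensor_tmul]
        induction δ a with
        | zero => simp
        | add x y hx hy => simp only [map_add, TensorProduct.add_tmul, hx, hy]
        | tmul c d => simp
    have h₂ : TensorProduct.lift (φ.compl₂ (ψ.flip w)) ∘ₗ δ =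
        (LinearMap.toSpanSingleton k W w) ∘ₗ counit (R := k) (A := C) := by
      ext c
      simp [h]
    rw [twist_tmul, h₁, hδ.coassoc, ← LinearMap.comp_apply, ← LinearMap.lTensor_comp, h₂,
      LinearMap.lTensor_comp, LinearMap.comp_apply, hδ.counit]
    simp

lemma twist_bijective {δ : C →ₗ[k] C ⊗[k] C} (hδ : IsComul δ) {φ ψ : C →ₗ[k] Module.End k W}
    (h : ∀ c w, TensorProduct.lift (φ.compl₂ (ψ.flip w)) (δ c) = counit (R := k) c • w)
    (h' : ∀ c w, TensorProduct.lift (ψ.compl₂ (φ.flip w)) (δ c) = counit (R := k) c • w) :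
    Function.Bijective (twist δ φ) :=
  Function.bijective_iff_has_inverse.2 ⟨twist δ ψ, twist_twist hδ h', twist_twist hδ h⟩

end Twist


section TwistHopf

variable {k : Type*} [CommRing k] {H W : Type*} [Ring H] [HopfAlgebra k H]
  [AddCommGroup W] [Module k W]

lemma lift_compl₂_algHom (ρ : H →ₐ[k] Module.End k W) (f g : H →ₗ[k] H) (w : W) (t : H ⊗[k] H) :
    TensorProduct.lift ((ρ.toLinearMap ∘ₗ f).compl₂ ((ρ.toLinearMap ∘ₗ g).flip w)) t =
      ρ (LinearMap.mul' k H (TensorProduct.map f g t)) w := by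
  induction t with
  | zero => simp
  | add x y hx hy => simp only [map_add, hx, hy, LinearMap.add_apply]
  | tmul a b => simp

lemma twist_comul_bijective (ρ : H →ₐ[k] Module.End k W) :
    Function.Bijective (twist (comul (R := k) (A := H)) ρ.toLinearMap) := by
  refine twist_bijective isComul_comul
    (ψ := ρ.toLinearMap ∘ₗ HopfAlgebra.antipode k) (fun c w => ?_) (fun c w => ?_)
  · have := lift_compl₂_algHom ρ LinearMap.id (HopfAlgebra.antipode k) w (comul c)
    rw [LinearMap.comp_id] at this
    rw [this]
    erw [HopfAlgebra.mul_antipode_lTensor_comul_apply]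
    simp [Algebra.algebraMap_eq_smul_one]
  · have := lift_compl₂_algHom ρ (HopfAlgebra.antipode k) LinearMap.id w (comul c)
    rw [LinearMap.comp_id] at this
    rw [this]
    erw [HopfAlgebra.mul_antipode_rTensor_comul_apply]
    simp [Algebra.algebraMap_eq_smul_one]

lemma antipode_mul'_map (f g f' g' : H →ₗ[k] H) (hf : HopfAlgebra.antipode k ∘ₗ f = g')
    (hg : HopfAlgebra.antipode k ∘ₗ g = f') (t : H ⊗[k] H) :
    HopfAlgebra.antipode k
      (LinearMap.mul' k H (TensorProduct.map f g (TensorProduct.comm k H H t))) =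
      LinearMap.mul' k H (TensorProduct.map f' g' t) := by
  subst hf hg
  induction t with
  | zero => simp
  | add x y hx hy => simp only [map_add, hx, hy]
  | tmul a b => simp [HopfAlgebra.antipode_mul_antidistrib]

lemma antipode_algebraMap (c : k) :
    HopfAlgebra.antipode k (algebraMap k H c) = algebraMap k H c := by
  simp [Algebra.algebraMap_eq_smul_one]

lemma twist_comm_comul_bijective
    (hS : Function.Bijective (HopfAlgebra.antipode (R := k) (A := H)))
    (ρ : H →ₐ[k] Module.End k W) :
    Function.Bijective (twist ((TensorProduct.comm k H H).toLinearMap ∘ₗ comul (R := k) (A := H))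
      ρ.toLinearMap) := by
  let e := LinearEquiv.ofBijective _ hS
  have he : HopfAlgebra.antipode k ∘ₗ e.symm.toLinearMap = LinearMap.id := by
    ext x
    exact e.apply_symm_apply x
  refine twist_bijective isComul_comm_comul
    (ψ := ρ.toLinearMap ∘ₗ e.symm.toLinearMap) (fun c w => ?_) (fun c w => ?_)
  · have := lift_compl₂_algHom ρ LinearMap.id e.symm.toLinearMap w
      (TensorProduct.comm k H H (comul c))
    rw [LinearMap.comp_id] at this
    have h : LinearMap.mul' k H (TensorProduct.map LinearMap.id e.symm.toLinearMap
        (TensorProduct.comm k H H (comul c))) = algebraMap k H (counit c) := by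
      apply hS.injective
      rw [antipode_mul'_map _ _ _ _ (LinearMap.comp_id _) he, antipode_algebraMap]
      exact HopfAlgebra.mul_antipode_lTensor_comul_apply c
    simp only [LinearMap.comp_apply, LinearEquiv.coe_coe] at this ⊢
    rw [this, h]
    simp [Algebra.algebraMap_eq_smul_one]
  · have := lift_compl₂_algHom ρ e.symm.toLinearMap LinearMap.id w
      (TensorProduct.comm k H H (comul c))
    rw [LinearMap.comp_id] at this
    have h : LinearMap.mul' k H (TensorProduct.map e.symm.toLinearMap LinearMap.id
        (TensorProduct.comm k H H (comul c))) = algebraMap k H (counit c) := by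
      apply hS.injective
      rw [antipode_mul'_map _ _ _ _ he (LinearMap.comp_id _), antipode_algebraMap]
      exact HopfAlgebra.mul_antipode_rTensor_comul_apply c
    simp only [LinearMap.comp_apply, LinearEquiv.coe_coe] at this ⊢
    rw [this, h]
    simp [Algebra.algebraMap_eq_smul_one]

end TwistHopf

section Diag

/-- The tensor product `M ⊗[k] N` with the diagonal `H`-module structure. -/
@[nolint unusedArguments]
def Diag (k : Type u) [Field k] (H : Type u) [Ring H] [HopfAlgebra k H]
    (M N : Type u) [AddCommGroup M] [Module k M] [AddCommGroup N] [Module k N] : Type u :=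
  M ⊗[k] N

variable (k : Type u) [Field k] (H : Type u) [Ring H] [HopfAlgebra k H]
  (M N : Type u) [AddCommGroup M] [Module k M] [Module H M] [IsScalarTower k H M]
  [AddCommGroup N] [Module k N] [Module H N] [IsScalarTower k H N]

noncomputable instance : AddCommGroup (Diag k H M N) := inferInstanceAs (AddCommGroup (M ⊗[k] N))

noncomputable instance : Module k (Diag k H M N) := inferInstanceAs (Module k (M ⊗[k] N))

noncomputable instance : Module H (Diag k H M N) := tensorModule k H M N

/-- The identification of the underlying `k`-module of `Diag k H M N` with `M ⊗[k] N`. -/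
def Diag.of : M ⊗[k] N ≃ₗ[k] Diag k H M N := LinearEquiv.refl k _

/-- The action of `H ⊗ H` on `M ⊗ N`. -/
noncomputable def tensorAct : H ⊗[k] H →ₗ[k] Module.End k (M ⊗[k] N) :=
  ((Module.endTensorEndAlgHom (R := k) (S := k) (A := k) (M := M) (N := N)).comp
    (Algebra.TensorProduct.map (hRep k H M) (hRep k H N))).toLinearMap

variable {k H M N}

lemma tensorAct_tmul (a b : H) (m : M) (n : N) :
    tensorAct k H M N (a ⊗ₜ b) (m ⊗ₜ n) = (a • m) ⊗ₜ (b • n) := rfl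

lemma Diag.smul_of (h : H) (z : M ⊗[k] N) :
    h • Diag.of k H M N z = Diag.of k H M N (tensorAct k H M N (comul h) z) := rfl

instance : IsScalarTower k H (Diag k H M N) where
  smul_assoc c h z := by
    obtain ⟨z, rfl⟩ := (Diag.of k H M N).surjective z
    simp [Diag.smul_of]

variable {M' N' : Type u}
  [AddCommGroup M'] [Module k M'] [Module H M'] [IsScalarTower k H M']
  [AddCommGroup N'] [Module k N'] [Module H N'] [IsScalarTower k H N']

variable (k) in
/-- Functoriality of the diagonal tensor product. -/
noncomputable def Diag.map (f : M →ₗ[H] M') (g : N →ₗ[H] N') :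
    Diag k H M N →ₗ[H] Diag k H M' N' where
  toFun z := Diag.of k H M' N'
    (TensorProduct.map (f.restrictScalars k) (g.restrictScalars k) ((Diag.of k H M N).symm z))
  map_add' := by simp
  map_smul' h z := by
    obtain ⟨z, rfl⟩ := (Diag.of k H M N).surjective z
    simp only [Diag.smul_of, LinearEquiv.symm_apply_apply, RingHom.id_apply]
    congr 1
    induction comul (R := k) h with
    | zero => simp
    | add x y hx hy => simp only [map_add, hx, hy, LinearMap.add_apply]
    | tmul a b =>
      induction z with
      | zero => simp
      | add x y hx hy => simp only [map_add, hx, hy]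
      | tmul m n => simp [tensorAct_tmul]

lemma Diag.map_of_tmul (f : M →ₗ[H] M') (g : N →ₗ[H] N') (m : M) (n : N) :
    Diag.map k f g (Diag.of k H M N (m ⊗ₜ n)) = Diag.of k H M' N' (f m ⊗ₜ g n) := rfl

lemma Diag.map_left_injective (f : M →ₗ[H] M') (hf : Function.Injective f) :
    Function.Injective (Diag.map k f (LinearMap.id : N →ₗ[H] N)) :=
  Module.Flat.rTensor_preserves_injective_linearMap (M := N) (f.restrictScalars k) hf

lemma Diag.map_right_injective (g : N →ₗ[H] N') (hg : Function.Injective g) :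
    Function.Injective (Diag.map k (LinearMap.id : M →ₗ[H] M) g) :=
  Module.Flat.lTensor_preserves_injective_linearMap (M := M) (g.restrictScalars k) hg

lemma Diag.map_left_surjective (f : M →ₗ[H] M') (hf : Function.Surjective f) :
    Function.Surjective (Diag.map k f (LinearMap.id : N →ₗ[H] N)) :=
  LinearMap.rTensor_surjective N (g := f.restrictScalars k) hf

lemma Diag.map_right_surjective (g : N →ₗ[H] N') (hg : Function.Surjective g) :
    Function.Surjective (Diag.map k (LinearMap.id : M →ₗ[H] M) g) :=
  LinearMap.lTensor_surjective M (g := g.restrictScalars k) hg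

section Exact

variable {X Y Z : Type u}
  [AddCommGroup X] [Module k X] [Module H X] [IsScalarTower k H X]
  [AddCommGroup Y] [Module k Y] [Module H Y] [IsScalarTower k H Y]
  [AddCommGroup Z] [Module k Z] [Module H Z] [IsScalarTower k H Z]

lemma Diag.map_left_exact (f : X →ₗ[H] Y) (g : Y →ₗ[H] Z) (h : Function.Exact f g)
    (hg : Function.Surjective g) :
    Function.Exact (Diag.map k f (LinearMap.id : N →ₗ[H] N)) (Diag.map k g LinearMap.id) :=
  rTensor_exact N (f := f.restrictScalars k) (g := g.restrictScalars k) h hg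

lemma Diag.map_right_exact (f : X →ₗ[H] Y) (g : Y →ₗ[H] Z) (h : Function.Exact f g)
    (hg : Function.Surjective g) :
    Function.Exact (Diag.map k (LinearMap.id : M →ₗ[H] M) f) (Diag.map k LinearMap.id g) :=
  lTensor_exact M (f := f.restrictScalars k) (g := g.restrictScalars k) h hg

/-- Associativity of the diagonal tensor product. -/
noncomputable def Diag.assoc :
    Diag k H (Diag k H X Y) Z ≃ₗ[H] Diag k H X (Diag k H Y Z) :=
  let e : (X ⊗[k] Y) ⊗[k] Z ≃ₗ[k] X ⊗[k] (Y ⊗[k] Z) := TensorProduct.assoc k X Y Z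
  { e with
    map_smul' h z := by
      let actL : (H ⊗[k] H) ⊗[k] H →ₗ[k] Module.End k ((X ⊗[k] Y) ⊗[k] Z) :=
        ((Module.endTensorEndAlgHom (R := k) (S := k) (A := k)).comp
          (Algebra.TensorProduct.map ((Module.endTensorEndAlgHom (R := k) (S := k) (A := k)).comp
            (Algebra.TensorProduct.map (hRep k H X) (hRep k H Y))) (hRep k H Z))).toLinearMap
      let actR : H ⊗[k] (H ⊗[k] H) →ₗ[k] Module.End k (X ⊗[k] (Y ⊗[k] Z)) :=
        ((Module.endTensorEndAlgHom (R := k) (S := k) (A := k)).comp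
          (Algebra.TensorProduct.map (hRep k H X)
            ((Module.endTensorEndAlgHom (R := k) (S := k) (A := k)).comp
            (Algebra.TensorProduct.map (hRep k H Y) (hRep k H Z))))).toLinearMap
      have hL : ∀ (t : H ⊗[k] H) z, tensorAct k H (Diag k H X Y) Z t z =
          actL ((comul (R := k) (A := H)).rTensor H t) z := by
        intro t z
        induction t with
        | zero => simp only [map_zero, LinearMap.zero_apply]; rfl
        | add x y hx hy => simp only [map_add, hx, hy, LinearMap.add_apply]; rfl
        | tmul a b => rfl
      have hR : ∀ (t : H ⊗[k] H) z, tensorAct k H X (Diag k H Y Z) t z =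
          actR ((comul (R := k) (A := H)).lTensor H t) z := by
        intro t z
        induction t with
        | zero => simp only [map_zero, LinearMap.zero_apply]; rfl
        | add x y hx hy => simp only [map_add, hx, hy, LinearMap.add_apply]; rfl
        | tmul a b => rfl
      have hLR : ∀ (t : (H ⊗[k] H) ⊗[k] H) z,
          e (actL t z) = actR (TensorProduct.assoc k H H H t) (e z) := by
        intro t z
        have : (LinearMap.llcomp k _ _ _ e.toLinearMap) ∘ₗ actL =
            (LinearMap.lcomp k _ e.toLinearMap) ∘ₗ actR ∘ₗ
              (TensorProduct.assoc k H H H).toLinearMap := by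
          ext a b c x y z
          rfl
        exact congr($this t z)
      change e (tensorAct k H (Diag k H X Y) Z (comul h) z) =
        tensorAct k H X (Diag k H Y Z) (comul h) (e z)
      refine (congrArg e (hL _ z)).trans (Eq.trans ?_ (hR _ (e z)).symm)
      rw [← coassoc_apply]
      exact hLR _ z }

end Exact

section Free

variable {V : Type u} [AddCommGroup V] [Module k V]

/-- The `H`-linear map `h ⊗ w ↦ h • l w` extending a `k`-linear map `l`. -/
noncomputable def inducedHom (l : V →ₗ[k] M) : H ⊗[k] V →ₗ[H] M :=
  TensorProduct.AlgebraTensorModule.lift ((LinearMap.ringLmapEquivSelf H ℕ (V →ₗ[k] M)).symm l)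

@[simp]
lemma inducedHom_tmul (l : V →ₗ[k] M) (h : H) (v : V) : inducedHom l (h ⊗ₜ v) = h • l v := rfl

lemma projective_tensor : Module.Projective H (H ⊗[k] V) := inferInstance

variable (k) in
lemma exists_section_inducedHom [Module.Projective H M] :
    ∃ σ : M →ₗ[H] H ⊗[k] M, ∀ m, inducedHom (LinearMap.id : M →ₗ[k] M) (σ m) = m := by
  obtain ⟨σ, hσ⟩ := Module.projective_lifting_property
    (inducedHom (H := H) (LinearMap.id : M →ₗ[k] M)) LinearMap.id
    (fun m => ⟨1 ⊗ₜ m, by simp⟩)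
  exact ⟨σ, fun m => congr($hσ m)⟩

variable (N V) in
lemma inducedHom_left_bijective : Function.Bijective
    (inducedHom (H := H) ((Diag.of k H (H ⊗[k] V) N).toLinearMap ∘ₗ
      (TensorProduct.assoc k H V N).symm.toLinearMap ∘ₗ TensorProduct.mk k H (V ⊗[k] N) 1)) := by
  let ρ : H →ₐ[k] Module.End k (V ⊗[k] N) := (Module.End.lTensorAlgHom k N V).comp (hRep k H N)
  have key : ∀ z, inducedHom (H := H) ((Diag.of k H (H ⊗[k] V) N).toLinearMap ∘ₗ
      (TensorProduct.assoc k H V N).symm.toLinearMap ∘ₗ TensorProduct.mk k H (V ⊗[k] N) 1) z =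
      Diag.of k H (H ⊗[k] V) N ((TensorProduct.assoc k H V N).symm
        (twist (comul (R := k) (A := H)) ρ.toLinearMap z)) := by
    intro z
    induction z with
    | zero => simp
    | add x y hx hy => simp only [map_add, hx, hy]
    | tmul h w =>
      simp only [inducedHom_tmul, twist_tmul, LinearMap.comp_apply, LinearEquiv.coe_coe,
        Diag.smul_of]
      congr 1
      induction w with
      | zero => simp
      | add x y hx hy => simp only [map_add, hx, hy, LinearMap.lTensor_add, LinearMap.add_apply]
      | tmul v n =>
        induction comul (R := k) h with
        | zero => simp
        | add x y hx hy => simp only [map_add, hx, hy, LinearMap.add_apply]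
        | tmul a b =>
          simp only [TensorProduct.mk_apply, TensorProduct.assoc_symm_tmul, tensorAct_tmul,
            TensorProduct.smul_tmul', smul_eq_mul, mul_one, LinearMap.lTensor_tmul]
          rfl
  rw [funext key]
  exact (Diag.of k H (H ⊗[k] V) N).bijective.comp
    ((TensorProduct.assoc k H V N).symm.bijective.comp (twist_comul_bijective ρ))

variable (N V) in
/-- The untwisting isomorphism `h ⊗ (v ⊗ n) ↦ ∑ (h₁ ⊗ v) ⊗ h₂ n`. -/
noncomputable def untwistLeft : H ⊗[k] (V ⊗[k] N) ≃ₗ[H] Diag k H (H ⊗[k] V) N :=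
  LinearEquiv.ofBijective _ (inducedHom_left_bijective N V)

lemma untwistLeft_symm_of {n : N} (hn : ∀ h : H, h • n = counit (R := k) h • n) (h : H) (v : V) :
    (untwistLeft N V).symm (Diag.of k H (H ⊗[k] V) N ((h ⊗ₜ v) ⊗ₜ n)) = h ⊗ₜ (v ⊗ₜ n) := by
  rw [LinearEquiv.symm_apply_eq]
  change _ = h • Diag.of k H (H ⊗[k] V) N ((1 ⊗ₜ v) ⊗ₜ n)
  rw [Diag.smul_of]
  congr 1
  have : ∀ t : H ⊗[k] H, tensorAct k H (H ⊗[k] V) N t ((1 ⊗ₜ v) ⊗ₜ n) =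
      ((TensorProduct.mk k H V).flip v).rTensor N
        ((LinearMap.toSpanSingleton k N n).lTensor H ((counit (R := k) (A := H)).lTensor H t)) := by
    intro t
    induction t with
    | zero => simp
    | add x y hx hy => simp only [map_add, hx, hy, LinearMap.add_apply]
    | tmul a b => simp [tensorAct_tmul, TensorProduct.smul_tmul', hn]
  rw [this, lTensor_counit_comul]
  simp

variable (N V) in
lemma inducedHom_right_bijective
    (hS : Function.Bijective (HopfAlgebra.antipode (R := k) (A := H))) : Function.Bijective
    (inducedHom (H := H) ((Diag.of k H N (H ⊗[k] V)).toLinearMap ∘ₗ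
      (TensorProduct.leftComm k H N V).toLinearMap ∘ₗ TensorProduct.mk k H (N ⊗[k] V) 1)) := by
  let ρ : H →ₐ[k] Module.End k (N ⊗[k] V) := (Module.End.rTensorAlgHom k N V).comp (hRep k H N)
  have key : ∀ z, inducedHom (H := H) ((Diag.of k H N (H ⊗[k] V)).toLinearMap ∘ₗ
      (TensorProduct.leftComm k H N V).toLinearMap ∘ₗ TensorProduct.mk k H (N ⊗[k] V) 1) z =
      Diag.of k H N (H ⊗[k] V) (TensorProduct.leftComm k H N V
        (twist ((TensorProduct.comm k H H).toLinearMap ∘ₗ comul (R := k) (A := H))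
          ρ.toLinearMap z)) := by
    intro z
    induction z with
    | zero => simp
    | add x y hx hy => simp only [map_add, hx, hy]
    | tmul h w =>
      simp only [inducedHom_tmul, twist_tmul, LinearMap.comp_apply, LinearEquiv.coe_coe,
        Diag.smul_of]
      congr 1
      induction w with
      | zero => simp
      | add x y hx hy => simp only [map_add, hx, hy, LinearMap.lTensor_add, LinearMap.add_apply]
      | tmul n v =>
        induction comul (R := k) h with
        | zero => simp
        | add x y hx hy => simp only [map_add, hx, hy, LinearMap.add_apply]
        | tmul a b =>
          simp only [TensorProduct.mk_apply, TensorProduct.leftComm_tmul, tensorAct_tmul,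
            TensorProduct.smul_tmul', smul_eq_mul, mul_one, LinearMap.lTensor_tmul,
            TensorProduct.comm_tmul]
          rfl
  rw [funext key]
  exact (Diag.of k H N (H ⊗[k] V)).bijective.comp
    ((TensorProduct.leftComm k H N V).bijective.comp (twist_comm_comul_bijective hS ρ))

variable (k M N) in
lemma projective_diag_left [Module.Projective H M] : Module.Projective H (Diag k H M N) := by
  obtain ⟨σ, hσ⟩ := exists_section_inducedHom (H := H) (M := M) k
  have : Module.Projective H (Diag k H (H ⊗[k] M) N) :=
    Module.Projective.of_equiv (untwistLeft N M)
  refine Module.Projective.of_split (Diag.map k σ (LinearMap.id : N →ₗ[H] N))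
    (Diag.map k (inducedHom LinearMap.id) LinearMap.id) ?_
  ext z
  obtain ⟨z, rfl⟩ := (Diag.of k H M N).surjective z
  induction z with
  | zero => simp
  | add x y hx hy => simp only [map_add, hx, hy]
  | tmul m n => simp [Diag.map_of_tmul, hσ]

variable (k N M) in
lemma projective_diag_right
    (hS : Function.Bijective (HopfAlgebra.antipode (R := k) (A := H)))
    [Module.Projective H M] : Module.Projective H (Diag k H N M) := by
  obtain ⟨σ, hσ⟩ := exists_section_inducedHom (H := H) (M := M) k
  have : Module.Projective H (Diag k H N (H ⊗[k] M)) :=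
    Module.Projective.of_equiv (LinearEquiv.ofBijective _ (inducedHom_right_bijective N M hS))
  refine Module.Projective.of_split (Diag.map k (LinearMap.id : N →ₗ[H] N) σ)
    (Diag.map k LinearMap.id (inducedHom LinearMap.id)) ?_
  ext z
  obtain ⟨z, rfl⟩ := (Diag.of k H N M).surjective z
  induction z with
  | zero => simp
  | add x y hx hy => simp only [map_add, hx, hy]
  | tmul m n => simp [Diag.map_of_tmul, hσ]

/-- If `n` spans a trivial submodule of `N` and `Q` is projective, then `q ↦ q ⊗ n` is a split
monomorphism. -/
lemma exists_retraction_diag (Q : Type u) [AddCommGroup Q] [Module k Q] [Module H Q]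
    [IsScalarTower k H Q] [Module.Projective H Q] {n : N} (hn₀ : n ≠ 0)
    (hn : ∀ h : H, h • n = counit (R := k) h • n) :
    ∃ r : Diag k H Q N →ₗ[H] Q, ∀ q, r (Diag.of k H Q N (q ⊗ₜ n)) = q := by
  obtain ⟨σ, hσ⟩ := exists_section_inducedHom (H := H) (M := Q) k
  obtain ⟨p, hp⟩ := Module.Projective.exists_dual_eq_one k hn₀
  let π : H ⊗[k] (Q ⊗[k] N) →ₗ[H] Q :=
    inducedHom ((TensorProduct.rid k Q).toLinearMap ∘ₗ p.lTensor Q)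
  refine ⟨π ∘ₗ (untwistLeft N Q).symm.toLinearMap ∘ₗ Diag.map k σ LinearMap.id, fun q => ?_⟩
  have h₁ : ∀ t : H ⊗[k] Q, π ((untwistLeft N Q).symm (Diag.of k H (H ⊗[k] Q) N (t ⊗ₜ n))) =
      inducedHom (LinearMap.id : Q →ₗ[k] Q) t := by
    intro t
    induction t with
    | zero => simp
    | add x y hx hy => simp only [map_add, TensorProduct.add_tmul, hx, hy]
    | tmul h q => simp [untwistLeft_symm_of hn, π, hp]
  simp [Diag.map_of_tmul, h₁, hσ]

end Free

end Diag

section ProjectiveDimension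

open CategoryTheory

variable (R : Type u) [Ring R]

/-- The `R`-module `M` has projective dimension at most `n`. -/
def PdLE (n : ℕ) (M : Type u) [AddCommGroup M] [Module R M] : Prop :=
  HasProjectiveDimensionLT (ModuleCat.of R M) (n + 1)

variable {R} {M X Y Z : Type u} [AddCommGroup M] [Module R M] [AddCommGroup X] [Module R X]
  [AddCommGroup Y] [Module R Y] [AddCommGroup Z] [Module R Z]

lemma pdLE_zero_iff : PdLE R 0 M ↔ Module.Projective R M :=
  projective_iff_hasProjectiveDimensionLT_one.symm.trans
    (IsProjective.iff_projective M).symm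

lemma PdLE.mono {m n : ℕ} (hmn : m ≤ n) (h : PdLE R m M) : PdLE R n M := by
  unfold PdLE at *
  exact hasProjectiveDimensionLT_of_ge _ (m + 1) (n + 1) (by lia)

lemma PdLE.of_equiv {n : ℕ} (e : X ≃ₗ[R] Y) (h : PdLE R n X) : PdLE R n Y := by
  unfold PdLE at *
  exact hasProjectiveDimensionLT_of_iso e.toModuleIso (n + 1)

lemma pdLE_succ_iff {f : X →ₗ[R] Y} {g : Y →ₗ[R] Z} (hf : Function.Injective f)
    (hfg : Function.Exact f g) (hg : Function.Surjective g) (hY : Module.Projective R Y) (n : ℕ) :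
    PdLE R (n + 1) Z ↔ PdLE R n X :=
  (ModuleCat.shortComplex_shortExact
    (ShortComplex.mk (ModuleCat.ofHom f) (ModuleCat.ofHom g)
      (ModuleCat.hom_ext (LinearMap.ext hfg.apply_apply_eq_zero))) hfg hf
      hg).hasProjectiveDimensionLT_X₃_iff n ((IsProjective.iff_projective Y).1 hY)

lemma PdLE.of_projDimLE {n : ℕ} : ∀ {M : Type u} [AddCommGroup M] [Module R M],
    ProjDimLE R n M → PdLE R n M := by
  induction n with
  | zero => exact fun h => pdLE_zero_iff.2 h
  | succ n ih =>
    rintro M _ _ (h | ⟨P, f, hP, hf, h⟩)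
    · exact (pdLE_zero_iff.2 h).mono (Nat.zero_le _)
    · exact (pdLE_succ_iff (LinearMap.ker f).injective_subtype
        (LinearMap.exact_subtype_ker_map f) hf hP n).2 (ih h)

end ProjectiveDimension

section TotallyAcyclic

variable {R : Type u} [Ring R]

/-- There is a short exact sequence `0 → L → P → K → 0` with `P` projective such that every map
from `L` to a projective module extends to `P`. -/
def IsGorensteinSyzygy (K L : ModuleCat.{u} R) : Prop :=
  ∃ (P : ModuleCat.{u} R) (a : L →ₗ[R] P) (b : P →ₗ[R] K), Module.Projective R P ∧
    Function.Injective a ∧ Function.Exact a b ∧ Function.Surjective b ∧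
    ∀ Q : ModuleCat.{u} R, Module.Projective R Q → ∀ φ : L →ₗ[R] Q, ∃ ψ : P →ₗ[R] Q, ψ ∘ₗ a = φ

lemma exists_int_chain {α : Type*} (r : α → α → Prop) (hs : ∀ x, ∃ y, r x y)
    (hp : ∀ y, ∃ x, r x y) (x₀ : α) (m : ℤ) :
    ∃ f : ℤ → α, f m = x₀ ∧ ∀ i, r (f i) (f (i + 1)) := by
  choose s hs using hs
  choose p hp using hp
  let g : ℤ → α
    | .ofNat n => s^[n] x₀
    | .negSucc n => p^[n + 1] x₀
  have hg : ∀ i, r (g i) (g (i + 1)) := by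
    rintro (n | _ | n)
    · change r (s^[n] x₀) (s^[n + 1] x₀)
      rw [Function.iterate_succ_apply']
      exact hs _
    · exact hp _
    · change r (p^[n + 1 + 1] x₀) (p^[n + 1] x₀)
      rw [Function.iterate_succ_apply']
      exact hp _
  refine ⟨fun i => g (i - m), ?_, fun i => ?_⟩
  · simp only [sub_self]
    rfl
  · change r (g (i - m)) (g (i + 1 - m))
    rw [add_sub_right_comm]
    exact hg _

lemma isGorensteinProjective_of_chain (C : ℤ → ModuleCat.{u} R)
    (hC : ∀ i, IsGorensteinSyzygy (C i) (C (i + 1))) : IsGorensteinProjective R (C 2) := by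
  choose P a b hP ha hab hb hext using hC
  have hcomp (i : ℤ) (x : C (i + 1)) : b i (a i x) = 0 := (hab i).apply_apply_eq_zero x
  refine ⟨P, fun i => a i ∘ₗ b (i + 1), hP, fun i => ?_, fun Q hQ i f hf => ?_, ⟨?_⟩⟩
  · ext x
    simp only [LinearMap.mem_range, LinearMap.mem_ker, LinearMap.comp_apply]
    constructor
    · rintro ⟨y, rfl⟩
      simp [hcomp]
    · intro hx
      obtain ⟨z, rfl⟩ := (hab (i + 1) x).1 (ha i (hx.trans (map_zero _).symm))
      obtain ⟨y, rfl⟩ := hb (i + 1 + 1) z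
      exact ⟨y, rfl⟩
  · have hfa : LinearMap.ker (b (i + 1)) ≤ LinearMap.ker f := by
      intro x hx
      obtain ⟨z, rfl⟩ := (hab (i + 1) x).1 hx
      obtain ⟨y, rfl⟩ := hb (i + 1 + 1) z
      exact congr($hf y)
    obtain ⟨φ, hφ⟩ : ∃ φ : C (i + 1) →ₗ[R] Q, φ ∘ₗ b (i + 1) = f := by
      refine ⟨(LinearMap.ker (b (i + 1))).liftQ f hfa ∘ₗ
        ((b (i + 1)).quotKerEquivOfSurjective (hb _)).symm.toLinearMap, LinearMap.ext fun x => ?_⟩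
      have hx : ((b (i + 1)).quotKerEquivOfSurjective (hb _)).symm (b (i + 1) x) =
          (LinearMap.ker (b (i + 1))).mkQ x := by
        rw [LinearEquiv.symm_apply_eq]
        rfl
      simp [hx]
    obtain ⟨ψ, hψ⟩ := hext i Q hQ φ
    exact ⟨ψ, by rw [← LinearMap.comp_assoc, hψ, hφ]⟩
  · refine LinearEquiv.ofBijective ((a 1).codRestrict _ fun x => ?_) ⟨fun x y h => ?_, fun x => ?_⟩
    · exact (congrArg (a 0) (hcomp 1 x)).trans (map_zero _)
    · exact ha 1 congr(($h : P 1))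
    · obtain ⟨x, hx⟩ := x
      obtain ⟨z, rfl⟩ := (hab 1 x).1 (ha 0 (hx.trans (map_zero _).symm))
      exact ⟨z, rfl⟩

lemma isGorensteinProjective_of_class_s4 (𝒢 : ModuleCat.{u} R → Prop)
    (hs : ∀ K, 𝒢 K → ∃ L, 𝒢 L ∧ IsGorensteinSyzygy K L)
    (hp : ∀ L, 𝒢 L → ∃ K, 𝒢 K ∧ IsGorensteinSyzygy K L) (K : ModuleCat.{u} R) (hK : 𝒢 K) :
    IsGorensteinProjective R K := by
  obtain ⟨f, hf, hr⟩ := exists_int_chain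
    (fun x y : {K : ModuleCat.{u} R // 𝒢 K} => IsGorensteinSyzygy x.1 y.1)
    (fun x => let ⟨L, hL, h⟩ := hs x.1 x.2; ⟨⟨L, hL⟩, h⟩)
    (fun x => let ⟨L, hL, h⟩ := hp x.1 x.2; ⟨⟨L, hL⟩, h⟩) ⟨K, hK⟩ 2
  have h := isGorensteinProjective_of_chain (fun i => (f i).1) hr
  rwa [hf] at h

end TotallyAcyclic

section Main

variable {k : Type u} [Field k] {H : Type u} [Ring H] [HopfAlgebra k H]

variable (k) in
lemma exists_projective_cover (M : Type u) [AddCommGroup M] [Module k M] [Module H M]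
    [IsScalarTower k H M] :
    ∃ (P : Type u) (_ : AddCommGroup P) (_ : Module k P) (_ : Module H P)
      (_ : IsScalarTower k H P) (g : P →ₗ[H] M), Module.Projective H P ∧ Function.Surjective g :=
  ⟨H ⊗[k] M, inferInstance, inferInstance, inferInstance, inferInstance, inducedHom LinearMap.id,
    projective_tensor, fun m => ⟨1 ⊗ₜ m, by simp⟩⟩

lemma PdLE.diag (hS : Function.Bijective (HopfAlgebra.antipode (R := k) (A := H))) {n : ℕ}
    (N : Type u) [AddCommGroup N] [Module k N] [Module H N] [IsScalarTower k H N] :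
    ∀ {T : Type u} [AddCommGroup T] [Module k T] [Module H T] [IsScalarTower k H T],
      PdLE H n T → PdLE H n (Diag k H N T) := by
  induction n with
  | zero =>
    intro T _ _ _ _ hT
    have := pdLE_zero_iff.1 hT
    exact pdLE_zero_iff.2 (projective_diag_right k T N hS)
  | succ n ih =>
    intro T _ _ _ _ hT
    obtain ⟨P, _, _, _, _, g, hP, hg⟩ := exists_projective_cover (H := H) k T
    have hex : Function.Exact (LinearMap.ker g).subtype g := LinearMap.exact_subtype_ker_map g
    have hker := (pdLE_succ_iff (LinearMap.ker g).injective_subtype hex hg hP n).1 hT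
    exact (pdLE_succ_iff (Diag.map_right_injective _ (LinearMap.ker g).injective_subtype)
      (Diag.map_right_exact _ _ hex hg) (Diag.map_right_surjective _ hg)
      (projective_diag_right k P N hS) n).2 (ih hker)

variable (k H) in
/-- `M ⊗ T` has projective dimension at most `m` whenever `T` has projective dimension at
most `n`. -/
def DiagPdLE (n m : ℕ) (M : Type u) [AddCommGroup M] [Module k M] [Module H M]
    [IsScalarTower k H M] : Prop :=
  ∀ (T : Type u) [AddCommGroup T] [Module k T] [Module H T] [IsScalarTower k H T],
    PdLE H n T → PdLE H m (Diag k H M T)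

section Cover

variable {n m : ℕ} {X Y Z : Type u}
  [AddCommGroup X] [Module k X] [Module H X] [IsScalarTower k H X]
  [AddCommGroup Y] [Module k Y] [Module H Y] [IsScalarTower k H Y]
  [AddCommGroup Z] [Module k Z] [Module H Z] [IsScalarTower k H Z]

lemma diagPdLE_of_projective [Module.Projective H X] : DiagPdLE k H n 0 X :=
  fun T _ _ _ _ _ => pdLE_zero_iff.2 (projective_diag_left k X T)

lemma DiagPdLE.syzygy {f : X →ₗ[H] Y} {g : Y →ₗ[H] Z} (hf : Function.Injective f)
    (hfg : Function.Exact f g) (hg : Function.Surjective g) [Module.Projective H Y]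
    (h : DiagPdLE k H n (m + 1) Z) : DiagPdLE k H n m X :=
  fun T _ _ _ _ hT => (pdLE_succ_iff (Diag.map_left_injective f hf) (Diag.map_left_exact f g hfg hg)
    (Diag.map_left_surjective g hg) (projective_diag_left k Y T) m).1 (h T hT)

lemma DiagPdLE.diag (hS : Function.Bijective (HopfAlgebra.antipode (R := k) (A := H)))
    (h : DiagPdLE k H n m X) : DiagPdLE k H n m (Diag k H X Y) :=
  fun _ _ _ _ _ hT => (h _ (hT.diag hS Y)).of_equiv Diag.assoc.symm

end Cover

/-- Every map from `L` to a projective module extends along `L → L ⊗ Λ`, `x ↦ x ⊗ l`. -/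
lemma exists_extension_diag {Λ : Type u} [AddCommGroup Λ] [Module k Λ] [Module H Λ]
    [IsScalarTower k H Λ] {l : Λ} (hl₀ : l ≠ 0) (hl : ∀ h : H, h • l = counit (R := k) h • l)
    {L Q : Type u} [AddCommGroup L] [Module k L] [Module H L] [IsScalarTower k H L]
    [AddCommGroup Q] [Module H Q] [Module.Projective H Q] (φ : L →ₗ[H] Q) :
    ∃ ψ : Diag k H L Λ →ₗ[H] Q, ∀ x, ψ (Diag.of k H L Λ (x ⊗ₜ l)) = φ x := by
  let _ : Module k Q := Module.compHom Q (algebraMap k H)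
  have : IsScalarTower k H Q := IsScalarTower.of_algebraMap_smul fun _ _ => rfl
  obtain ⟨r, hr⟩ := exists_retraction_diag Q hl₀ hl
  exact ⟨r ∘ₗ Diag.map k φ LinearMap.id, fun x => hr (φ x)⟩

/-- The map `L → L ⊗ Λ`, `x ↦ x ⊗ l`, for a vector `l` spanning a trivial submodule. -/
noncomputable def Diag.inclusion (L : Type u) [AddCommGroup L] [Module k L] [Module H L]
    [IsScalarTower k H L] {Λ : Type u} [AddCommGroup Λ] [Module k Λ] [Module H Λ]
    [IsScalarTower k H Λ] {l : Λ} (hl : ∀ h : H, h • l = counit (R := k) h • l) :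
    L →ₗ[H] Diag k H L Λ where
  toFun x := Diag.of k H L Λ (x ⊗ₜ l)
  map_add' := by simp [TensorProduct.add_tmul]
  map_smul' h x := by
    rw [Diag.smul_of, RingHom.id_apply]
    congr 1
    have key : ∀ t : H ⊗[k] H, tensorAct k H L Λ t (x ⊗ₜ l) =
        TensorProduct.map (LinearMap.toSpanSingleton H L x |>.restrictScalars k)
          (LinearMap.toSpanSingleton k Λ l) ((counit (R := k) (A := H)).lTensor H t) := by
      intro t
      induction t with
      | zero => simp
      | add x y hx hy => simp only [map_add, hx, hy, LinearMap.add_apply]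
      | tmul a b => simp [tensorAct_tmul, hl]
    rw [key, lTensor_counit_comul]
    simp

lemma Diag.inclusion_injective {L Λ : Type u} [AddCommGroup L] [Module k L] [Module H L]
    [IsScalarTower k H L] [AddCommGroup Λ] [Module k Λ] [Module H Λ] [IsScalarTower k H Λ]
    {l : Λ} (hl : ∀ h : H, h • l = counit (R := k) h • l) (hl₀ : l ≠ 0) :
    Function.Injective (Diag.inclusion L hl) := by
  obtain ⟨p, hp⟩ := Module.Projective.exists_dual_eq_one k hl₀
  refine Function.LeftInverse.injective
    (g := fun z => TensorProduct.rid k L (p.lTensor L ((Diag.of k H L Λ).symm z))) fun x => ?_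
  simp [Diag.inclusion, hp]

section Gorenstein

variable {n : ℕ} {Λ : Type u} [AddCommGroup Λ] [Module k Λ] [Module H Λ] [IsScalarTower k H Λ]
  {l : Λ} {K : Type u} [AddCommGroup K] [Module k K] [Module H K] [IsScalarTower k H K]

lemma DiagPdLE.isGorensteinSyzygy_ker (hΛ : PdLE H n Λ) (hl₀ : l ≠ 0)
    (hl : ∀ h : H, h • l = counit (R := k) h • l) (hK : DiagPdLE k H n 0 K)
    {P : Type u} [AddCommGroup P] [Module k P] [Module H P] [IsScalarTower k H P]
    [Module.Projective H P] {g : P →ₗ[H] K} (hg : Function.Surjective g) :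
    IsGorensteinSyzygy (ModuleCat.of H K) (ModuleCat.of H (LinearMap.ker g)) := by
  have hex : Function.Exact (LinearMap.ker g).subtype g := LinearMap.exact_subtype_ker_map g
  refine ⟨ModuleCat.of H P, (LinearMap.ker g).subtype, g, ‹_›,
    (LinearMap.ker g).injective_subtype, hex, hg, fun Q hQ φ => ?_⟩
  obtain ⟨ψ, hψ⟩ := exists_extension_diag hl₀ hl φ
  have hproj : Module.Projective H (Diag k H K Λ) := pdLE_zero_iff.1 (hK Λ hΛ)
  obtain ⟨s, hs⟩ := Module.projective_lifting_property
    (Diag.map k g (LinearMap.id : Λ →ₗ[H] Λ)) LinearMap.id (Diag.map_left_surjective g hg)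
  have hsplit := (Diag.map_left_exact (k := k) (N := Λ) _ g hex hg).split_tfae'.out 0 1
  obtain ⟨-, r, hr⟩ := hsplit.1
    ⟨Diag.map_left_injective _ (LinearMap.ker g).injective_subtype, s, hs⟩
  refine ⟨ψ ∘ₗ r ∘ₗ Diag.inclusion P hl, LinearMap.ext fun x => ?_⟩
  have hx : r (Diag.of k H P Λ (x.1 ⊗ₜ l)) = Diag.of k H (LinearMap.ker g) Λ (x ⊗ₜ l) :=
    congr($hr (Diag.of k H (LinearMap.ker g) Λ (x ⊗ₜ l)))
  exact (congrArg ψ hx).trans (hψ x)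

lemma DiagPdLE.isGorensteinSyzygy_diag (hΛ : PdLE H n Λ) (hl₀ : l ≠ 0)
    (hl : ∀ h : H, h • l = counit (R := k) h • l) (hK : DiagPdLE k H n 0 K) :
    IsGorensteinSyzygy (ModuleCat.of H (Diag k H K (Λ ⧸ Submodule.span H {l})))
      (ModuleCat.of H K) := by
  let S := Submodule.span H {l}
  refine ⟨ModuleCat.of H (Diag k H K Λ), Diag.inclusion K hl,
    Diag.map k LinearMap.id (Submodule.mkQ S), pdLE_zero_iff.1 (hK Λ hΛ),
    Diag.inclusion_injective hl hl₀, fun z => ?_, Diag.map_right_surjective _ S.mkQ_surjective,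
    fun Q hQ φ => ?_⟩
  · rw [Diag.map_right_exact S.subtype S.mkQ (LinearMap.exact_subtype_mkQ S) S.mkQ_surjective z]
    constructor
    · rintro ⟨w, rfl⟩
      obtain ⟨w, rfl⟩ := (Diag.of k H K S).surjective w
      induction w with
      | zero => exact ⟨0, by simp⟩
      | add x y hx hy =>
        obtain ⟨x', hx⟩ := hx
        obtain ⟨y', hy⟩ := hy
        exact ⟨x' + y', by simp only [map_add, hx, hy]⟩
      | tmul x s =>
        obtain ⟨s, hs⟩ := s
        obtain ⟨h, rfl⟩ := Submodule.mem_span_singleton.1 hs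
        refine ⟨counit (R := k) h • x, ?_⟩
        simp [Diag.inclusion, Diag.map_of_tmul, hl]
    · rintro ⟨x, rfl⟩
      exact ⟨Diag.of k H K S (x ⊗ₜ ⟨l, Submodule.mem_span_singleton_self l⟩), rfl⟩
  · obtain ⟨ψ, hψ⟩ := exists_extension_diag hl₀ hl φ
    exact ⟨ψ, LinearMap.ext hψ⟩

lemma DiagPdLE.isGorensteinProjective
    (hS : Function.Bijective (HopfAlgebra.antipode (R := k) (A := H))) (hΛ : PdLE H n Λ)
    (hl₀ : l ≠ 0) (hl : ∀ h : H, h • l = counit (R := k) h • l) (hK : DiagPdLE k H n 0 K) :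
    IsGorensteinProjective H K := by
  refine isGorensteinProjective_of_class_s4 (fun K : ModuleCat.{u} H =>
    ∃ (_ : Module k K) (_ : IsScalarTower k H K), DiagPdLE k H n 0 K) ?_ ?_ (ModuleCat.of H K)
    ⟨_, ‹_›, hK⟩
  · rintro K ⟨_, _, hK⟩
    obtain ⟨P, _, _, _, _, g, hP, hg⟩ := exists_projective_cover (H := H) k K
    exact ⟨_, ⟨inferInstance, inferInstance, DiagPdLE.syzygy (LinearMap.ker g).injective_subtype
      (LinearMap.exact_subtype_ker_map g) hg fun T _ _ _ _ hT => (hK T hT).mono zero_le_one⟩,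
      hK.isGorensteinSyzygy_ker hΛ hl₀ hl hg⟩
  · rintro K ⟨_, _, hK⟩
    exact ⟨_, ⟨inferInstanceAs (Module k (Diag k H K (Λ ⧸ Submodule.span H {l}))),
      inferInstanceAs (IsScalarTower k H (Diag k H K (Λ ⧸ Submodule.span H {l}))), hK.diag hS⟩,
      hK.isGorensteinSyzygy_diag hΛ hl₀ hl⟩

lemma DiagPdLE.gProjDimLE
    (hS : Function.Bijective (HopfAlgebra.antipode (R := k) (A := H))) (hΛ : PdLE H n Λ)
    (hl₀ : l ≠ 0) (hl : ∀ h : H, h • l = counit (R := k) h • l) {m : ℕ} :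
    ∀ {K : Type u} [AddCommGroup K] [Module k K] [Module H K] [IsScalarTower k H K],
      DiagPdLE k H n m K → GProjDimLE H m K := by
  induction m with
  | zero => exact fun hK => hK.isGorensteinProjective hS hΛ hl₀ hl
  | succ m ih =>
    intro K _ _ _ _ hK
    obtain ⟨P, _, _, _, _, g, hP, hg⟩ := exists_projective_cover (H := H) k K
    exact Or.inr ⟨ModuleCat.of H P, g,
      (diagPdLE_of_projective (k := k) (X := P)).isGorensteinProjective hS hΛ hl₀ hl, hg,
      ih (hK.syzygy (LinearMap.ker g).injective_subtype (LinearMap.exact_subtype_ker_map g) hg)⟩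

end Gorenstein

end Main
/-- Let `H` be a Hopf algebra over a field `k` with bijective antipode, and
assume there is a monomorphism of left `H`-modules `ι : εk → Λ` with `pd_H(Λ) < ∞`. Then for
every left `H`-module `M` one has `Gpd_H(M) ≤ pd_H(Λ)`. -/
theorem gProjDim_le_projDim_of_mono (k : Type u) [Field k]
    (H : Type u) [Ring H] [HopfAlgebra k H]
    (hS : Function.Bijective (HopfAlgebra.antipode (R := k) (A := H)))
    (Λ : ModuleCat.{u} H) (ι : trivMod k H →ₗ[H] Λ)
    (hι : Function.Injective ι) (hΛ : projDim H Λ < ⊤)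
    (M : Type u) [AddCommGroup M] [Module H M] :
    gProjDim H M ≤ projDim H Λ := by
  let _ : Module k Λ := Module.compHom Λ (algebraMap k H)
  have : IsScalarTower k H Λ := IsScalarTower.of_algebraMap_smul fun _ _ => rfl
  let _ : Module k M := Module.compHom M (algebraMap k H)
  have : IsScalarTower k H M := IsScalarTower.of_algebraMap_smul fun _ _ => rfl
  obtain ⟨_, ⟨n, rfl, hn⟩, -⟩ := sInf_lt_iff.1 hΛ
  obtain ⟨m, hm, hm'⟩ : projDim H Λ ∈ {n : ℕ∞ | ∃ m : ℕ, n = (m : ℕ∞) ∧ ProjDimLE H m Λ} :=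
    csInf_mem ⟨_, n, rfl, hn⟩
  rw [hm]
  let l : Λ := ι (1 : k)
  have hl₀ : l ≠ 0 := fun h => one_ne_zero (α := k) (hι (h.trans (map_zero ι).symm))
  have hl (h : H) : h • l = counit (R := k) h • l := by
    have h₁ (h : H) : h • l = ι (counit (R := k) h : k) :=
      (ι.map_smul h (1 : k)).symm.trans (congrArg ι (mul_one (counit (R := k) h)))
    refine (h₁ h).trans (Eq.trans ?_ (h₁ (algebraMap k H (counit h))).symm)
    rw [Bialgebra.counit_algebraMap]
  have hpd := PdLE.of_projDimLE hm'
  exact sInf_le ⟨m, rfl, DiagPdLE.gProjDimLE (k := k) hS hpd hl₀ hl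
    fun T _ _ _ _ hT => hT.diag hS M⟩
end
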